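/- arXiv:2110.00089 — 8 statements merged into one kernel-verified Lean document; each statement's English description precedes it below -/
import Mathlib

section
/- Let d, m ≥ 2 be integers, let G = (ℤ/dℤ)^{⋆m} be the free product of m copies of the cyclic group of order d with x_i a fixed generator of the i-th factor, and let S = {x₁, …, x_m}. Then limsup_{n→∞} CL(n;G,S)^{1/n} = d·(m−1)^{1/d} / (d−1)^{(d−1)/d} (equivalently, the radius of convergence of the cogrowth series F_{G;S} is (d−1)^{(d−1)/d} / (d·(m−1)^{1/d})). -/
/-- `CL S n` is the number of words of length `n` over the alphabet `S` whose
product equals the identity of the group. -/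
noncomputable def CL {G : Type*} [Group G] (S : Set G) (n : ℕ) : ℕ :=
  Nat.card {w : Fin n → G // (∀ i, w i ∈ S) ∧ (List.ofFn w).prod = 1}

open Filter Topology

/-- `wordCount x n g` is the number of index words of length `n` whose product (in the letters `x`)
is the inverse of `g`, computed by stripping off last letters. -/
noncomputable def wordCount {G : Type*} [Group G] {m : ℕ} (x : Fin m → G) : ℕ → G → ℕ
  | 0, g => open scoped Classical in if g = 1 then 1 else 0
  | n + 1, g => ∑ i, wordCount x n (x i * g)

/-- A height function on a group for the left multiplication by the letters `x i`: away from `1`,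
exactly one letter lowers the height by one, and all others raise it by `d - 1`. -/
structure IsHeight {G : Type*} [Group G] {m : ℕ} (d : ℕ) (x : Fin m → G) (ht : G → ℕ) : Prop where
  eq_zero_iff : ∀ g, ht g = 0 ↔ g = 1
  letter : ∀ i, ht (x i) = d - 1
  step : ∀ g, g ≠ 1 → ∃ i₀, ht (x i₀ * g) + 1 = ht g ∧ ∀ i, i ≠ i₀ → ht (x i * g) = ht g + (d - 1)

section wordCount

variable {G : Type*} [Group G] {m d : ℕ} {x : Fin m → G} {ht : G → ℕ}

open scoped Classical in
theorem sum_ite_prod_eq_wordCount (x : Fin m → G) (n : ℕ) (g : G) :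
    (∑ v : Fin n → Fin m, if (List.ofFn fun i => x (v i)).prod * g = 1 then 1 else 0)
      = wordCount x n g := by
  induction n generalizing g with
  | zero => simp [wordCount]
  | succ n ih =>
    rw [← (Fin.snocEquiv fun _ : Fin (n + 1) => Fin m).sum_comp, Fintype.sum_prod_type, wordCount]
    refine Finset.sum_congr rfl fun i _ => ?_
    rw [← ih]
    refine Finset.sum_congr rfl fun v _ => ?_
    rw [List.ofFn_succ', List.concat_eq_append, List.prod_append]
    simp [Fin.snocEquiv, mul_assoc]

theorem CL_range_eq_wordCount (hx : Function.Injective x) (n : ℕ) :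
    CL (Set.range x) n = wordCount x n 1 := by
  classical
  rw [← sum_ite_prod_eq_wordCount, ← Finset.card_filter, ← Fintype.card_subtype,
    ← Nat.card_eq_fintype_card, CL]
  refine (Nat.card_congr (Equiv.ofBijective
    (fun v : {v : Fin n → Fin m // (List.ofFn fun i => x (v i)).prod * 1 = 1} =>
      (⟨fun i => x (v.1 i), fun i => ⟨_, rfl⟩, by simpa using v.2⟩ :
        {w : Fin n → G // (∀ i, w i ∈ Set.range x) ∧ (List.ofFn w).prod = 1})) ⟨?_, ?_⟩)).symm
  · rintro ⟨v, _⟩ ⟨v', _⟩ h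
    rw [Subtype.mk.injEq] at h ⊢
    exact funext fun i => hx (congrFun h i)
  · rintro ⟨w, hw, hp⟩
    obtain ⟨v, hv⟩ := Classical.skolem.1 hw
    obtain rfl : (fun i => x (v i)) = w := funext hv
    exact ⟨⟨v, by simpa using hp⟩, rfl⟩

theorem IsHeight.injective (h : IsHeight d x ht) (hd : 2 ≤ d) : Function.Injective x := by
  intro i j hij
  have hxi : x i ≠ 1 := fun h1 => by
    have := (h.eq_zero_iff _).2 h1
    rw [h.letter] at this
    omega
  obtain ⟨i₀, -, h₀⟩ := h.step (x i)⁻¹ (by simpa using hxi)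
  have key : ∀ k, x k = x i → k = i₀ := fun k hk => by
    by_contra hne
    have := h₀ k hne
    rw [hk, mul_inv_cancel, (h.eq_zero_iff 1).2 rfl] at this
    omega
  rw [key i rfl, key j hij.symm]

theorem IsHeight.wordCount_le (h : IsHeight d x ht) (hd : 2 ≤ d) {C q : ℝ} (hq : 0 < q)
    (hq1 : q ≤ 1) (hC : C * q = 1 + ((m : ℝ) - 1) * q ^ d) (hm : 1 ≤ m) (n : ℕ) (g : G) :
    (wordCount x n g : ℝ) ≤ C ^ n * q ^ ht g := by
  have hm' : (0 : ℝ) ≤ (m : ℝ) - 1 := by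
    have : (1 : ℝ) ≤ m := by exact_mod_cast hm
    linarith
  have hC0 : 0 < C := by
    refine pos_of_mul_pos_left ?_ hq.le
    rw [hC]
    exact add_pos_of_pos_of_nonneg one_pos (mul_nonneg hm' (pow_nonneg hq.le _))
  induction n generalizing g with
  | zero =>
    by_cases hg : g = 1
    · simp [wordCount, hg, (h.eq_zero_iff 1).2 rfl]
    · simp only [wordCount, hg, if_false, Nat.cast_zero]
      positivity
  | succ n ih =>
    rw [wordCount]
    push_cast
    refine (Finset.sum_le_sum fun i _ => ih (x i * g)).trans ?_
    rw [← Finset.mul_sum, pow_succ, mul_assoc]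
    refine mul_le_mul_of_nonneg_left ?_ (by positivity)
    by_cases hg : g = 1
    · subst hg
      simp only [mul_one, h.letter, (h.eq_zero_iff 1).2 rfl, Finset.sum_const, Finset.card_univ,
        Fintype.card_fin, nsmul_eq_mul, pow_zero]
      refine le_of_mul_le_mul_right ?_ hq
      rw [hC, mul_assoc, ← pow_succ, Nat.sub_add_cancel (by omega)]
      have := pow_le_one₀ hq.le hq1 (n := d)
      linarith
    · obtain ⟨i₀, h1, h2⟩ := h.step g hg
      rw [← Finset.add_sum_erase _ _ (Finset.mem_univ i₀),
        Finset.sum_congr rfl fun i hi => by rw [h2 i (Finset.ne_of_mem_erase hi)],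
        Finset.sum_const, Finset.card_erase_of_mem (Finset.mem_univ _), Finset.card_univ,
        Fintype.card_fin, nsmul_eq_mul, Nat.cast_sub hm, ← h1,
        show ht (x i₀ * g) + 1 + (d - 1) = ht (x i₀ * g) + d by omega, pow_succ, pow_add,
        mul_comm (q ^ _) q, ← mul_assoc C, hC]
      apply le_of_eq
      push_cast
      ring

/-- A ballot-type number: the number of nonnegative lattice paths from height `v` to `0` with `k`
up-steps of size `e` and down-steps of size one. -/
def ballot (e : ℕ) : ℕ → ℕ → ℤ
  | 0, _ => 1
  | k + 1, v => ((e + 1) * (k + 1) + v).choose (k + 1) - e * ((e + 1) * (k + 1) + v).choose k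

theorem ballot_succ_succ (e k v : ℕ) :
    ballot e (k + 1) (v + 1) = ballot e (k + 1) v + ballot e k (v + (e + 1)) := by
  cases k with
  | zero =>
    simp only [ballot, zero_add, mul_one, Nat.choose_one_right, Nat.choose_zero_right]
    push_cast
    ring
  | succ k =>
    simp only [ballot]
    rw [show (e + 1) * (k + 1) + (v + (e + 1)) = (e + 1) * (k + 1 + 1) + v by ring, ← add_assoc,
      Nat.choose_succ_succ, Nat.choose_succ_succ _ k]
    push_cast
    ring

theorem ballot_succ_zero (e k : ℕ) : ballot e (k + 1) 0 = ballot e k e := by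
  have hN : ∀ k, ((e + 1) * k + e).choose (k + 1) = e * ((e + 1) * k + e).choose k := fun k => by
    have := Nat.choose_succ_right_eq ((e + 1) * k + e) k
    rw [show (e + 1) * k + e - k = e * (k + 1) by
      rw [show (e + 1) * k + e = e * (k + 1) + k by ring]; simp] at this
    refine Nat.eq_of_mul_eq_mul_right (Nat.succ_pos k) ?_
    rw [Nat.succ_eq_add_one, this]
    ring
  cases k with
  | zero => simp [ballot]
  | succ k =>
    simp only [ballot, add_zero]
    rw [show (e + 1) * (k + 1 + 1) = (e + 1) * (k + 1) + e + 1 by ring, Nat.choose_succ_succ,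
      Nat.choose_succ_succ _ k, hN (k + 1)]
    push_cast
    ring

theorem ballot_zero_mul (e k : ℕ) :
    (e * k + 1) * ballot e k 0 = ((e + 1) * k).choose k := by
  cases k with
  | zero => simp [ballot]
  | succ k =>
    simp only [ballot, add_zero]
    have := Nat.choose_succ_right_eq ((e + 1) * (k + 1)) k
    rw [show (e + 1) * (k + 1) - k = e * (k + 1) + 1 by
      rw [show (e + 1) * (k + 1) = e * (k + 1) + 1 + k by ring]; simp] at this
    zify at this
    push_cast
    linear_combination (e : ℤ) * this

theorem IsHeight.le_wordCount (h : IsHeight d x ht) {e : ℕ} (hde : d = e + 1)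
    (hm : 1 ≤ m) (n k : ℕ) (g : G) (hn : n = d * k + ht g) :
    ((m - 1 : ℕ) : ℤ) ^ k * ballot e k (ht g) ≤ wordCount x n g := by
  subst hde
  induction n generalizing k g with
  | zero =>
    obtain ⟨hk, hg⟩ : k = 0 ∧ ht g = 0 := by simpa using hn.symm
    subst hk
    simp [ballot, wordCount, (h.eq_zero_iff g).1 hg]
  | succ n ih =>
    rw [wordCount]
    push_cast
    by_cases hg : g = 1
    · subst hg
      rw [(h.eq_zero_iff 1).2 rfl] at hn ⊢
      obtain ⟨k, rfl⟩ : ∃ j, k = j + 1 := Nat.exists_eq_succ_of_ne_zero (by rintro rfl; simp at hn)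
      rw [ballot_succ_zero]
      have hi : ∀ i ∈ Finset.univ, ((m - 1 : ℕ) : ℤ) ^ k * ballot e k e ≤
          wordCount x n (x i * 1) := fun i _ => by
        have := ih k (x i * 1) (by rw [mul_one, h.letter]; simp; linarith)
        rw [mul_one] at this ⊢
        rwa [h.letter, Nat.add_sub_cancel] at this
      have hsum := Finset.sum_le_sum hi
      have hpos : 0 ≤ ∑ i, (wordCount x n (x i * 1) : ℤ) := Finset.sum_nonneg fun _ _ => by simp
      rw [Finset.sum_const, Finset.card_univ, Fintype.card_fin, nsmul_eq_mul] at hsum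
      rcases le_total 0 (((m - 1 : ℕ) : ℤ) ^ k * ballot e k e) with h0 | h0
      · push_cast [hm] at hsum h0 ⊢
        rw [pow_succ]
        linarith
      · refine le_trans ?_ hpos
        rw [pow_succ, mul_right_comm]
        exact mul_nonpos_of_nonpos_of_nonneg h0 (by simp)
    · obtain ⟨i₀, h1, h2⟩ := h.step g hg
      rw [← Finset.add_sum_erase _ _ (Finset.mem_univ i₀)]
      rw [← h1] at hn ⊢
      cases k with
      | zero =>
        have := ih 0 (x i₀ * g) (by simpa using hn)
        have hpos : 0 ≤ ∑ i ∈ Finset.univ.erase i₀, (wordCount x n (x i * g) : ℤ) :=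
          Finset.sum_nonneg fun _ _ => by simp
        simp only [ballot] at this ⊢
        linarith
      | succ k =>
        have hlow := ih (k + 1) (x i₀ * g) (by linarith)
        have hi : ∀ i ∈ Finset.univ.erase i₀,
            ((m - 1 : ℕ) : ℤ) ^ k * ballot e k (ht (x i₀ * g) + (e + 1)) ≤
              wordCount x n (x i * g) := fun i hi => by
          have hh : ht (x i * g) = ht (x i₀ * g) + (e + 1) := by
            have := h2 i (Finset.ne_of_mem_erase hi)
            omega
          have := ih k (x i * g) (by rw [hh]; linarith)
          rwa [hh] at this
        have hsum := Finset.sum_le_sum hi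
        rw [Finset.sum_const, Finset.card_erase_of_mem (Finset.mem_univ _), Finset.card_univ,
          Fintype.card_fin, nsmul_eq_mul] at hsum
        rw [ballot_succ_succ]
        rw [mul_add, pow_succ] at *
        linarith

end wordCount

theorem pow_le_mul_choose_mul_pow (e k : ℕ) :
    (e + 1) ^ ((e + 1) * k) ≤
      ((e + 1) * k + 1) * (((e + 1) * k).choose k * e ^ (e * k)) := by
  set n := (e + 1) * k with hn
  have hkn : k ≤ n := by rw [hn]; nlinarith
  let T : ℕ → ℕ := fun j => n.choose j * e ^ (n - j)
  have hup : ∀ j, j < k → T j ≤ T (j + 1) := fun j hj => by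
    have hj' : n - j = (n - (j + 1)) + 1 := by omega
    have hc := Nat.choose_succ_right_eq n j
    have hle : e * (j + 1) ≤ n - j := by
      have : (e + 1) * (j + 1) ≤ n := Nat.mul_le_mul_left _ hj
      have : (e + 1) * (j + 1) = e * (j + 1) + j + 1 := by ring
      omega
    have : n.choose j * e ≤ n.choose (j + 1) := by
      refine Nat.le_of_mul_le_mul_right (c := j + 1) ?_ (Nat.succ_pos j)
      rw [hc, mul_assoc]
      exact Nat.mul_le_mul_left _ hle
    simp only [T]
    rw [hj', pow_succ, mul_comm (e ^ _) e, ← mul_assoc]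
    exact Nat.mul_le_mul_right _ this
  have hdown : ∀ j, k ≤ j → T (j + 1) ≤ T j := fun j hj => by
    rcases Nat.lt_or_ge j n with hjn | hjn
    · have hj' : n - j = (n - (j + 1)) + 1 := by omega
      have hc := Nat.choose_succ_right_eq n j
      have hle : n - j ≤ e * (j + 1) := by
        have : (e + 1) * k ≤ (e + 1) * j := Nat.mul_le_mul_left _ hj
        have : (e + 1) * j = e * j + j := by ring
        have : e * (j + 1) = e * j + e := by ring
        omega
      have : n.choose (j + 1) ≤ n.choose j * e := by
        refine Nat.le_of_mul_le_mul_right (c := j + 1) ?_ (Nat.succ_pos j)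
        rw [hc, mul_assoc]
        exact Nat.mul_le_mul_left _ hle
      simp only [T]
      rw [hj', pow_succ, mul_comm (e ^ _) e, ← mul_assoc]
      exact Nat.mul_le_mul_right _ this
    · simp [T, Nat.choose_eq_zero_of_lt (Nat.lt_succ_of_le hjn)]
  have hmax : ∀ j, T j ≤ T k := fun j => by
    rcases le_total k j with hj | hj
    · induction j, hj using Nat.le_induction with
      | base => exact le_rfl
      | succ j hj ih => exact (hdown j hj).trans ih
    · induction hj using Nat.decreasingInduction with
      | self => exact le_rfl
      | of_succ j hj ih => exact (hup j hj).trans ih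
  calc (e + 1) ^ n = (1 + e) ^ n := by rw [add_comm]
    _ = ∑ j ∈ Finset.range (n + 1), T j := by
      rw [add_pow]
      refine Finset.sum_congr rfl fun j _ => ?_
      simp [T, mul_comm]
    _ ≤ ∑ j ∈ Finset.range (n + 1), T k := Finset.sum_le_sum fun j _ => hmax j
    _ = (n + 1) * (n.choose k * e ^ (e * k)) := by
      have : n - k = e * k := by rw [hn, add_mul, one_mul, Nat.add_sub_cancel]
      simp [T, this]

section Height

open Monoid.CoprodI

variable {m d : ℕ}

/-- The number of multiplications by the standard generator needed to turn `a` into `1`. -/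
def letterHeight (a : Multiplicative (ZMod d)) : ℕ :=
  if a = 1 then 0 else d - a.toAdd.val

/-- The total height of the letters of a reduced word. -/
def wordHeight (w : Word fun _ : Fin m => Multiplicative (ZMod d)) : ℕ :=
  (w.toList.map fun l => letterHeight l.2).sum

theorem wordHeight_rcons {i : Fin m} (p : Word.Pair (fun _ : Fin m => Multiplicative (ZMod d)) i) :
    wordHeight (Word.rcons p) = letterHeight p.head + wordHeight p.tail := by
  unfold Word.rcons
  split_ifs with h
  · simp [h, letterHeight]
  · simp [wordHeight]

theorem letterHeight_ofAdd_one (hd : 2 ≤ d) :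
    letterHeight (Multiplicative.ofAdd (1 : ZMod d)) = d - 1 := by
  have : Fact (1 < d) := ⟨hd⟩
  simp [letterHeight, ZMod.val_one]

theorem letterHeight_ofAdd_one_mul (hd : 2 ≤ d) {a : Multiplicative (ZMod d)} (ha : a ≠ 1) :
    letterHeight (Multiplicative.ofAdd (1 : ZMod d) * a) + 1 = letterHeight a := by
  have : Fact (1 < d) := ⟨hd⟩
  have : NeZero d := ⟨by omega⟩
  have hlt := ZMod.val_lt a.toAdd
  have hval := ZMod.val_add (1 : ZMod d) a.toAdd
  rw [ZMod.val_one] at hval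
  simp only [letterHeight, ha, if_false]
  split_ifs with h
  · have h0 : (1 : ZMod d) + a.toAdd = 0 := h
    rw [h0, ZMod.val_zero] at hval
    have := Nat.le_of_dvd (by omega) (Nat.dvd_of_mod_eq_zero hval.symm)
    omega
  · have h0 : (1 : ZMod d) + a.toAdd ≠ 0 := h
    rw [← ZMod.val_ne_zero] at h0
    rw [toAdd_mul, toAdd_ofAdd]
    rcases Nat.lt_or_ge (1 + a.toAdd.val) d with hl | hl
    · rw [Nat.mod_eq_of_lt hl] at hval
      omega
    · rw [show 1 + a.toAdd.val = d by omega, Nat.mod_self] at hval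
      exact absurd hval h0

theorem letterHeight_pos (hd : 2 ≤ d) {a : Multiplicative (ZMod d)} (ha : a ≠ 1) :
    0 < letterHeight a := by
  have := letterHeight_ofAdd_one_mul hd ha
  omega

theorem wordHeight_eq_zero_iff (hd : 2 ≤ d)
    (w : Word fun _ : Fin m => Multiplicative (ZMod d)) : wordHeight w = 0 ↔ w = .empty := by
  refine ⟨fun h => ?_, by rintro rfl; simp [wordHeight]⟩
  induction w using Word.consRecOn with
  | empty => rfl
  | cons i a w h1 h2 ih =>
    have := letterHeight_pos hd h2
    simp [wordHeight] at h
    omega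

theorem wordHeight_of_smul (hd : 2 ≤ d) (i : Fin m)
    (w : Word fun _ : Fin m => Multiplicative (ZMod d)) :
    (w.fstIdx = some i →
      wordHeight (of (M := fun _ : Fin m => Multiplicative (ZMod d)) (i := i)
        (Multiplicative.ofAdd (1 : ZMod d)) • w) + 1 = wordHeight w) ∧
    (w.fstIdx ≠ some i →
      wordHeight (of (M := fun _ : Fin m => Multiplicative (ZMod d)) (i := i)
        (Multiplicative.ofAdd (1 : ZMod d)) • w) = wordHeight w + (d - 1)) := by
  rw [Word.of_smul_def, wordHeight_rcons]
  constructor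
  · intro h
    have hw : w = Word.rcons (Word.equivPair i w) := by
      rw [← Word.equivPair_symm, Equiv.symm_apply_apply]
    have hne : (Word.equivPair i w).head ≠ 1 := fun h1 => by
      rw [Word.rcons, dif_pos h1] at hw
      exact (Word.equivPair i w).fstIdx_ne (hw ▸ h)
    have := letterHeight_ofAdd_one_mul hd hne
    conv_rhs => rw [hw, wordHeight_rcons]
    dsimp only
    omega
  · intro h
    rw [Word.equivPair_eq_of_fstIdx_ne h]
    dsimp only
    rw [mul_one, letterHeight_ofAdd_one hd, add_comm]

theorem isHeight_wordHeight (hd : 2 ≤ d) :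
    IsHeight d (fun i : Fin m => of (M := fun _ : Fin m => Multiplicative (ZMod d)) (i := i)
      (Multiplicative.ofAdd (1 : ZMod d)))
      (fun g => wordHeight (g • (Word.empty : Word fun _ : Fin m => Multiplicative (ZMod d)))) where
  eq_zero_iff g := by
    rw [wordHeight_eq_zero_iff hd]
    refine ⟨fun h => ?_, by rintro rfl; simp⟩
    have := congrArg Word.prod h
    simpa using this
  letter i := by
    rw [(wordHeight_of_smul hd i _).2 (by simp [Word.fstIdx])]
    simp [wordHeight]
  step g hg := by
    have hne : g • (Word.empty : Word fun _ : Fin m => Multiplicative (ZMod d)) ≠ .empty :=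
      fun h => hg (by simpa using congrArg Word.prod h)
    obtain ⟨i₀, hi₀⟩ :
        ∃ i₀, (g • (Word.empty : Word fun _ : Fin m => Multiplicative (ZMod d))).fstIdx
          = some i₀ := by
      generalize g • (Word.empty : Word fun _ : Fin m => Multiplicative (ZMod d)) = w at hne
      induction w using Word.consRecOn with
      | empty => exact absurd rfl hne
      | cons i a w h1 h2 ih => exact ⟨i, by simp⟩
    refine ⟨i₀, ?_, fun i hi => ?_⟩
    · rw [mul_smul]
      exact (wordHeight_of_smul hd i₀ _).1 hi₀
    · rw [mul_smul]
      exact (wordHeight_of_smul hd i _).2 (by rw [hi₀]; simpa using hi.symm)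

end Height

theorem limsup_rpow_eq_of_le_of_frequently_le {a : ℕ → ℝ} {C : ℝ} (ha : ∀ n, 0 ≤ a n)
    (hC : 0 ≤ C) (hle : ∀ n, a n ≤ C ^ n)
    (hge : ∃ᶠ n : ℕ in atTop, C ^ n ≤ ((n : ℝ) + 1) ^ (2 : ℝ) * a n) :
    limsup (fun n : ℕ => a n ^ (1 / (n : ℝ))) atTop = C := by
  have hub : ∀ᶠ n : ℕ in atTop, a n ^ (1 / (n : ℝ)) ≤ C := by
    filter_upwards [eventually_ne_atTop 0] with n hn
    calc a n ^ (1 / (n : ℝ)) ≤ (C ^ n) ^ (1 / (n : ℝ)) :=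
          Real.rpow_le_rpow (ha n) (hle n) (by positivity)
      _ = C := by rw [one_div, Real.pow_rpow_inv_natCast hC hn]
  have hcob : IsCoboundedUnder (· ≤ ·) atTop fun n : ℕ => a n ^ (1 / (n : ℝ)) :=
    IsBoundedUnder.isCoboundedUnder_le ⟨0, eventually_map.2 (.of_forall fun n =>
      Real.rpow_nonneg (ha n) _)⟩
  refine le_antisymm (limsup_le_of_le hcob hub) ?_
  have hlim : Tendsto (fun n : ℕ => C * (((n : ℝ) + 1) ^ ((2 : ℝ) / (1 * ((n : ℝ) + 1) + (-1))))⁻¹)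
      atTop (𝓝 C) := by
    have h1 := (tendsto_rpow_div_mul_add 2 1 (-1) zero_ne_one).comp
      (tendsto_atTop_add_const_right atTop (1 : ℝ) tendsto_natCast_atTop_atTop)
    simpa using (h1.inv₀ one_ne_zero).const_mul C
  refine le_of_forall_lt fun c hc => ?_
  obtain ⟨c', hcc', hc'⟩ := exists_between hc
  refine hcc'.trans_le (le_limsup_of_frequently_le ?_ ⟨C, eventually_map.2 hub⟩)
  refine (hge.and_eventually ((hlim.eventually (lt_mem_nhds hc')).and
    (eventually_ne_atTop 0))).mono ?_
  rintro n ⟨hn, hn', hn0⟩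
  refine hn'.le.trans ?_
  have hpos : (0 : ℝ) < (n : ℝ) + 1 := by positivity
  rw [mul_inv_le_iff₀ (Real.rpow_pos_of_pos hpos _)]
  calc C = (C ^ n) ^ (1 / (n : ℝ)) := by rw [one_div, Real.pow_rpow_inv_natCast hC hn0]
    _ ≤ (((n : ℝ) + 1) ^ (2 : ℝ) * a n) ^ (1 / (n : ℝ)) :=
      Real.rpow_le_rpow (by positivity) hn (by positivity)
    _ = _ := by
      rw [Real.mul_rpow (by positivity) (ha n), ← Real.rpow_mul hpos.le, mul_comm]
      rw [show (1 : ℝ) * ((n : ℝ) + 1) + (-1) = n by ring, mul_one_div]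

/-- For `d, m ≥ 2`, the exponential growth rate
`limsup CL(n;G,S)^{1/n}` of the cogrowth of `(ℤ/dℤ)^{⋆m}` with respect to
`S = {x₁,…,x_m}` equals `d (m−1)^{1/d} / (d−1)^{(d−1)/d}`. -/
theorem cogrowth_limsup_free_product_cyclic (d m : ℕ) (hd : 2 ≤ d) (hm : 2 ≤ m)
    (x : Fin m → Monoid.CoprodI (fun _ : Fin m => Multiplicative (ZMod d)))
    (hx : ∀ i, x i = Monoid.CoprodI.of (i := i) (Multiplicative.ofAdd (1 : ZMod d))) :
    Filter.limsup (fun n : ℕ => (CL (Set.range x) n : ℝ) ^ (1 / (n : ℝ))) Filter.atTop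
      = (d : ℝ) * ((m : ℝ) - 1) ^ ((1 : ℝ) / (d : ℝ))
          / ((d : ℝ) - 1) ^ (((d : ℝ) - 1) / (d : ℝ)) := by
  obtain rfl : x = _ := funext hx
  have hH := isHeight_wordHeight (m := m) hd
  simp only [CL_range_eq_wordCount (hH.injective hd)]
  obtain ⟨e, rfl⟩ : ∃ e, d = e + 1 := ⟨d - 1, by omega⟩
  obtain ⟨M, rfl⟩ : ∃ M, m = M + 1 := ⟨m - 1, by omega⟩
  have he : (1 : ℝ) ≤ e := by exact_mod_cast (by omega : 1 ≤ e)
  have hM : (1 : ℝ) ≤ M := by exact_mod_cast (by omega : 1 ≤ M)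
  have he0 : (0 : ℝ) < e := by linarith
  have hM0 : (0 : ℝ) < M := by linarith
  have hH1 := (hH.eq_zero_iff 1).2 rfl
  push_cast
  simp only [add_sub_cancel_right]
  set C : ℝ := ((e : ℝ) + 1) * (M : ℝ) ^ ((1 : ℝ) / ((e : ℝ) + 1))
    / (e : ℝ) ^ ((e : ℝ) / ((e : ℝ) + 1)) with hCdef
  have hC0 : 0 < C := by positivity
  have hroot : ∀ y : ℝ, 0 ≤ y → (y ^ ((1 : ℝ) / ((e : ℝ) + 1))) ^ (e + 1) = y := fun y hy => by
    rw [← Real.rpow_natCast, ← Real.rpow_mul hy]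
    push_cast
    rw [one_div_mul_cancel (by positivity), Real.rpow_one]
  have hCpow : C ^ (e + 1) * (e : ℝ) ^ e = ((e : ℝ) + 1) ^ (e + 1) * M := by
    have : ((e : ℝ) ^ ((e : ℝ) / ((e : ℝ) + 1))) ^ (e + 1) = (e : ℝ) ^ e := by
      rw [← Real.rpow_natCast, ← Real.rpow_mul he0.le]
      push_cast
      rw [div_mul_cancel₀ _ (by positivity), Real.rpow_natCast]
    rw [hCdef, div_pow, mul_pow, hroot _ hM0.le, this]
    field_simp
  refine limsup_rpow_eq_of_le_of_frequently_le (fun n => Nat.cast_nonneg _) hC0.le ?_ ?_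
  · intro n
    set r : ℝ := ((M : ℝ) * e) ^ ((1 : ℝ) / ((e : ℝ) + 1)) with hr
    have hr0 : 0 < r := by positivity
    have hr1 : 1 ≤ r := Real.one_le_rpow (by nlinarith) (by positivity)
    have hrpow : r ^ (e + 1) = M * e := hroot _ (by positivity)
    have hCr : C * e = r * (e + 1) := by
      refine (pow_left_inj₀ (by positivity) (by positivity) (Nat.succ_ne_zero e)).1 ?_
      rw [Nat.succ_eq_add_one, mul_pow, mul_pow, hrpow, pow_succ (e : ℝ) e, ← mul_assoc, hCpow]
      ring
    have := hH.wordCount_le hd (C := C) (q := r⁻¹) (by positivity) (inv_le_one_of_one_le₀ hr1)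
      (by
        rw [inv_pow, hrpow]
        push_cast
        field_simp
        linear_combination (M : ℝ) * hCr) (by omega) n 1
    rwa [hH1, pow_zero, mul_one] at this
  · refine Filter.frequently_atTop.2 fun N => ⟨(e + 1) * N, Nat.le_mul_of_pos_left _ (by omega), ?_⟩
    have hlow := hH.le_wordCount rfl (by omega) ((e + 1) * N) N 1 (by rw [hH1, add_zero])
    rw [hH1, Nat.add_sub_cancel] at hlow
    have hb := ballot_zero_mul e N
    have hp := pow_le_mul_choose_mul_pow e N
    suffices ∀ W : ℕ, (M : ℤ) ^ N * ballot e N 0 ≤ W →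
        C ^ ((e + 1) * N) ≤ ((((e + 1) * N : ℕ) : ℝ) + 1) ^ (2 : ℝ) * W from this _ hlow
    clear hlow
    intro W hlow
    have hlow' : (M : ℝ) ^ N * (ballot e N 0 : ℝ) ≤ W := by exact_mod_cast hlow
    have hb' : ((e : ℝ) * N + 1) * (ballot e N 0 : ℝ) = (((e + 1) * N).choose N : ℝ) := by
      exact_mod_cast hb
    have hp' : ((e : ℝ) + 1) ^ ((e + 1) * N) ≤
        (((e : ℝ) + 1) * N + 1) * ((((e + 1) * N).choose N : ℝ) * (e : ℝ) ^ (e * N)) := by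
      exact_mod_cast hp
    have hE : (0 : ℝ) < (e : ℝ) ^ (e * N) := by positivity
    refine le_of_mul_le_mul_right ?_ hE
    push_cast
    rw [Real.rpow_two]
    have hN : (0 : ℝ) ≤ N := Nat.cast_nonneg N
    calc C ^ ((e + 1) * N) * (e : ℝ) ^ (e * N) = ((e : ℝ) + 1) ^ ((e + 1) * N) * (M : ℝ) ^ N := by
          rw [pow_mul, pow_mul, ← mul_pow, hCpow, mul_pow, ← pow_mul]
      _ ≤ ((((e : ℝ) + 1) * N + 1) *
            ((((e : ℝ) * N + 1) * (ballot e N 0 : ℝ)) * (e : ℝ) ^ (e * N))) * (M : ℝ) ^ N := by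
          rw [hb']
          exact mul_le_mul_of_nonneg_right hp' (by positivity)
      _ = (((e : ℝ) + 1) * N + 1) * ((e : ℝ) * N + 1) *
            ((M : ℝ) ^ N * (ballot e N 0 : ℝ)) * (e : ℝ) ^ (e * N) := by ring
      _ ≤ (((e : ℝ) + 1) * N + 1) * ((e : ℝ) * N + 1) * W * (e : ℝ) ^ (e * N) := by
          gcongr
      _ ≤ (((e : ℝ) + 1) * N + 1) * (((e : ℝ) + 1) * N + 1) * W * (e : ℝ) ^ (e * N) := by
          gcongr
          linarith
      _ = _ := by ring
end

section
/- Let H be a finite group with generating set T ⊆ H, and let F(t) = Σ_{n≥0} CL(n;H,T)·tⁿ ∈ ℤ[[t]] be its cogrowth series. Then there exist polynomials P, Q ∈ ℤ[t] with P(0) = Q(0) = 1, deg P ≤ |H| − 1 and deg Q ≤ |H|, such that Q(t)·F(t) = P(t) as formal power series; in particular F is the power series expansion of the rational function P/Q. Moreover, if H is not abelian, then such P and Q can be chosen with deg P ≤ |H| − 2 and deg Q ≤ |H| − 1. -/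
/-- The cogrowth series with integer coefficients. -/
noncomputable def cogrowthSeriesInt {G : Type*} [Group G] (S : Set G) : PowerSeries ℤ :=
  PowerSeries.mk fun n => (CL S n : ℤ)

open Polynomial in
/-- A sequence with `c 0 = 1` that is annihilated by the linear recurrence with monic characteristic
polynomial `g` has a rational generating function, with denominator the reverse of `g`. -/
theorem exists_rational_of_recurrence {R : Type*} [CommRing R] [Nontrivial R] {c : ℕ → R}
    (hc : c 0 = 1) {g : R[X]} (hg : g.Monic)
    (hrec : ∀ m, ∑ j ∈ Finset.range (g.natDegree + 1), g.coeff j * c (m + j) = 0) :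
    ∃ P Q : R[X], P.coeff 0 = 1 ∧ Q.coeff 0 = 1 ∧ P.natDegree ≤ g.natDegree - 1 ∧
      Q.natDegree ≤ g.natDegree ∧
      (Q : PowerSeries R) * PowerSeries.mk c = (P : PowerSeries R) := by
  obtain ⟨d, hd⟩ : ∃ d, g.natDegree = d + 1 := by
    refine Nat.exists_eq_succ_of_ne_zero fun h0 => ?_
    have := hrec 0
    rw [h0] at this
    have h1 : g.coeff 0 = 1 := by simpa [h0] using hg.coeff_natDegree
    simp [h1, hc] at this
  refine ⟨PowerSeries.trunc (d + 1) ((g.reverse : PowerSeries R) * PowerSeries.mk c), g.reverse,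
    ?_, ?_, ?_, g.reverse_natDegree_le, ?_⟩
  · simp [PowerSeries.coeff_trunc, hc, hg.leadingCoeff, PowerSeries.coeff_mul]
  · simp [hg.leadingCoeff]
  · have := PowerSeries.natDegree_trunc_lt ((g.reverse : PowerSeries R) * PowerSeries.mk c) d
    omega
  · ext n
    rw [Polynomial.coeff_coe, PowerSeries.coeff_trunc]
    split_ifs with hn
    · rfl
    obtain ⟨m, rfl⟩ := Nat.exists_eq_add_of_le (not_lt.mp hn)
    rw [PowerSeries.coeff_mul, Finset.Nat.sum_antidiagonal_eq_sum_range_succ_mk, ← hrec m, hd]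
    have hsub : Finset.range (d + 1 + 1) ⊆ Finset.range (d + 1 + m).succ := by
      intro i; simp; omega
    rw [← Finset.sum_subset hsub, ← Finset.sum_range_reflect]
    · refine Finset.sum_congr rfl fun j hj => ?_
      have hj' : j ≤ d + 1 := by simpa [Nat.lt_succ_iff] using hj
      simp only [Polynomial.coeff_coe, PowerSeries.coeff_mk, coeff_reverse, hd]
      rw [revAt_le (by omega)]
      congr 2 <;> omega
    · intro i _ hi
      have hi' : d + 1 < i := by simpa [Nat.lt_succ_iff] using hi
      simp only [Polynomial.coeff_coe]
      rw [coeff_eq_zero_of_natDegree_lt (lt_of_le_of_lt g.reverse_natDegree_le (by omega)), zero_mul]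

/-- An element of an algebra over a fraction field which is integral over an integrally closed
domain is annihilated by a monic polynomial over that domain of the degree of its minimal
polynomial over the field. -/
theorem IsIntegral.exists_monic_natDegree_eq_minpoly {R : Type*} (K : Type*) {A : Type*}
    [CommRing R] [IsDomain R]
    [IsIntegrallyClosed R] [Field K] [Algebra R K] [IsFractionRing R K] [Ring A] [Algebra R A]
    [Algebra K A] [IsScalarTower R K A] {a : A} (ha : IsIntegral R a) :
    ∃ g : Polynomial R, g.Monic ∧ Polynomial.aeval a g = 0 ∧
      g.natDegree = (minpoly K a).natDegree := by
  have haK : IsIntegral K a := ha.tower_top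
  obtain ⟨f, hf, hfa⟩ := ha
  have hdvd : minpoly K a ∣ f.map (algebraMap R K) := by
    apply minpoly.dvd
    rwa [Polynomial.aeval_map_algebraMap]
  obtain ⟨g, hg⟩ := IsIntegrallyClosed.eq_map_mul_C_of_dvd K hf hdvd
  rw [(minpoly.monic haK).leadingCoeff, Polynomial.C_1, mul_one] at hg
  have hinj := IsFractionRing.injective R K
  refine ⟨g, ?_, ?_, ?_⟩
  · exact Polynomial.monic_of_injective hinj (hg ▸ minpoly.monic haK)
  · rw [← Polynomial.aeval_map_algebraMap K, hg, minpoly.aeval]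
  · rw [← hg, Polynomial.natDegree_map_eq_of_injective hinj]

/-- If the minimal polynomial of `a` has the dimension of the algebra as its degree, then the
algebra is generated by `a`, hence commutative. -/
theorem commute_of_natDegree_minpoly_eq_finrank {K A : Type*} [Field K] [Ring A] [Algebra K A]
    [FiniteDimensional K A] {a : A} (h : (minpoly K a).natDegree = Module.finrank K A) (x y : A) :
    Commute x y := by
  have hspan := (linearIndependent_pow (K := K) a).span_eq_top_of_card_eq_finrank' (by simpa using h)
  have hpow (z : A) (hz : ∀ n : ℕ, Commute (a ^ n) z) (w : A) : Commute w z := by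
    have hw : w ∈ Submodule.span K
        (Set.range fun i : Fin (minpoly K a).natDegree => a ^ (i : ℕ)) := hspan ▸ trivial
    induction hw using Submodule.span_induction with
    | mem u hu => obtain ⟨i, rfl⟩ := hu; exact hz i
    | zero => exact Commute.zero_left z
    | add u v _ _ hu hv => exact hu.add_left hv
    | smul r u _ hu => exact hu.smul_left r
  exact hpow y (fun n => (hpow (a ^ n) (fun m => (Commute.refl a).pow_pow m n) y).symm) x

/-- The powers of the sum of the alphabet in the monoid algebra enumerate the words. -/
theorem sum_single_pow_eq_sum_words {G ι : Type*} (R : Type*) [Monoid G] [Semiring R] [Fintype ι]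
    (f : ι → G) (n : ℕ) :
    (∑ i, MonoidAlgebra.single (f i) (1 : R)) ^ n =
      ∑ w : Fin n → ι, MonoidAlgebra.single (List.ofFn fun i => f (w i)).prod (1 : R) := by
  induction n with
  | zero => simp [MonoidAlgebra.one_def]
  | succ n ih =>
    rw [pow_succ', ih, Finset.sum_mul_sum, ← Fintype.sum_prod_type']
    refine Fintype.sum_equiv (Fin.consEquiv fun _ => ι) _ _ fun p => ?_
    simp [Fin.consEquiv, MonoidAlgebra.single_mul_single, List.ofFn_succ]

theorem CL_eq_coeff_pow {G : Type*} (R : Type*) [Group G] [Semiring R] (S : Set G) [Fintype S]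
    (n : ℕ) :
    (CL S n : R) = ((∑ s : S, MonoidAlgebra.single (s : G) (1 : R)) ^ n).coeff 1 := by
  classical
  have e : {w : Fin n → G // (∀ i, w i ∈ S) ∧ (List.ofFn w).prod = 1} ≃
      {w : Fin n → S // (List.ofFn fun i => (w i : G)).prod = 1} :=
    { toFun := fun w => ⟨fun i => ⟨w.1 i, w.2.1 i⟩, w.2.2⟩
      invFun := fun w => ⟨fun i => w.1 i, fun i => (w.1 i).2, w.2⟩
      left_inv := fun _ => rfl
      right_inv := fun _ => rfl }
  rw [sum_single_pow_eq_sum_words, CL, Nat.card_congr e, Nat.card_eq_fintype_card,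
    Fintype.card_subtype, MonoidAlgebra.coeff_sum, Finsupp.finsetSum_apply]
  simp [Finsupp.single_apply]

/-- The sum of the alphabet in the rational group algebra of a finite group is an algebraic
integer. -/
theorem isIntegral_sum_single {H : Type*} [Group H] [Finite H] (S : Set H) [Fintype S] :
    IsIntegral ℤ (∑ s : S, MonoidAlgebra.single (s : H) (1 : ℚ)) := by
  have : Module.Finite ℤ (MonoidAlgebra ℤ H) := Module.Finite.of_basis (MonoidAlgebra.basis H ℤ)
  have h := (Algebra.IsIntegral.isIntegral (R := ℤ)
    (∑ s : S, MonoidAlgebra.single (s : H) (1 : ℤ))).map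
    (MonoidAlgebra.lift ℤ (MonoidAlgebra ℚ H) H (MonoidAlgebra.of ℚ H))
  simpa [map_sum] using h

/-- The cogrowth series of a finite group is rational, with degrees controlled by the minimal
polynomial of the sum of the alphabet in the rational group algebra. -/
theorem cogrowthSeriesInt_rational_minpoly {H : Type*} [Group H] [Finite H] (S : Set H)
    [Fintype S] {d : ℕ}
    (hd : (minpoly ℚ (∑ s : S, MonoidAlgebra.single (s : H) (1 : ℚ))).natDegree ≤ d) :
    ∃ P Q : Polynomial ℤ, P.coeff 0 = 1 ∧ Q.coeff 0 = 1 ∧ P.natDegree ≤ d - 1 ∧ Q.natDegree ≤ d ∧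
      (Q : PowerSeries ℤ) * cogrowthSeriesInt S = (P : PowerSeries ℤ) := by
  set a := ∑ s : S, MonoidAlgebra.single (s : H) (1 : ℚ) with ha
  obtain ⟨g, hg, hga, hgd⟩ := (isIntegral_sum_single S).exists_monic_natDegree_eq_minpoly ℚ
  rw [← ha] at hga hgd
  have hCL (n : ℕ) : (CL S n : ℚ) = (a ^ n).coeff 1 := CL_eq_coeff_pow ℚ S n
  have h0 : CL S 0 = 1 := by
    have := hCL 0
    simp only [pow_zero, MonoidAlgebra.one_def, MonoidAlgebra.coeff_single,
      Finsupp.single_eq_same] at this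
    exact_mod_cast this
  obtain ⟨P, Q, hP, hQ, hPd, hQd, h⟩ :=
    exists_rational_of_recurrence (c := fun n => (CL S n : ℤ)) (by simp [h0]) hg fun m => by
      have h := congrArg (fun x : MonoidAlgebra ℚ H => (a ^ m * x).coeff 1) hga
      simp only [Polynomial.aeval_eq_sum_range, Finset.mul_sum, mul_smul_comm, ← pow_add,
        MonoidAlgebra.coeff_sum, Finsupp.finsetSum_apply, mul_zero, MonoidAlgebra.coeff_zero,
        MonoidAlgebra.coeff_smul, Finsupp.smul_apply, ← hCL, Finsupp.zero_apply] at h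
      simp only [zsmul_eq_mul] at h
      exact_mod_cast h
  exact ⟨P, Q, hP, hQ, by omega, by omega, h⟩

/-- Let `H` be a finite group with generating set `T`, and let
`F ∈ ℤ[[t]]` be its cogrowth series.  Then there are `P, Q ∈ ℤ[t]` with
`P(0) = Q(0) = 1`, `deg P ≤ |H| − 1`, `deg Q ≤ |H|` and `Q·F = P`; moreover, if
`H` is not abelian then `P, Q` can be chosen with `deg P ≤ |H| − 2` and
`deg Q ≤ |H| − 1`. -/
theorem cogrowth_series_finite_group_rational {H : Type*} [Group H] [Finite H]
    (T : Set H) (hgen : Subgroup.closure T = ⊤)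
    (F : PowerSeries ℤ) (hF : F = cogrowthSeriesInt T) :
    (∃ P Q : Polynomial ℤ, P.coeff 0 = 1 ∧ Q.coeff 0 = 1
        ∧ P.natDegree ≤ Nat.card H - 1 ∧ Q.natDegree ≤ Nat.card H
        ∧ (Q : PowerSeries ℤ) * F = (P : PowerSeries ℤ))
      ∧ (¬ (∀ a b : H, a * b = b * a) →
          ∃ P Q : Polynomial ℤ, P.coeff 0 = 1 ∧ Q.coeff 0 = 1
            ∧ P.natDegree ≤ Nat.card H - 2 ∧ Q.natDegree ≤ Nat.card H - 1
            ∧ (Q : PowerSeries ℤ) * F = (P : PowerSeries ℤ)) := by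
  subst hF
  have := Fintype.ofFinite T
  have : Module.Finite ℚ (MonoidAlgebra ℚ H) := Module.Finite.of_basis (MonoidAlgebra.basis H ℚ)
  have hrank : Module.finrank ℚ (MonoidAlgebra ℚ H) = Nat.card H :=
    Module.finrank_eq_nat_card_basis (MonoidAlgebra.basis H ℚ)
  have hle := minpoly.natDegree_le (A := ℚ) (∑ s : T, MonoidAlgebra.single (s : H) (1 : ℚ))
  refine ⟨cogrowthSeriesInt_rational_minpoly T (hrank ▸ hle), fun hab => ?_⟩
  refine cogrowthSeriesInt_rational_minpoly T (Nat.le_sub_one_of_lt (hrank ▸ hle.lt_of_ne ?_))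
  refine fun h => hab fun x y => MonoidAlgebra.of_injective (R := ℚ) ?_
  rw [map_mul, map_mul]
  exact commute_of_natDegree_minpoly_eq_finrank h _ _
end

section
/- Let G₁, …, G_r be finite groups with generating sets S₁, …, S_r, and suppose for each i there are polynomials P_i, Q_i ∈ ℤ[t] with P_i(0) = Q_i(0) = 1 such that Q_i(t)·F_{G_i;S_i}(t) = P_i(t) as formal power series; set Δ_i := max(deg P_i + 1, deg Q_i). Let m₁, …, m_r be positive integers, let G = G₁^{⋆m₁} ⋆ ⋯ ⋆ G_r^{⋆m_r} be the free product of m₁ copies of G₁, …, m_r copies of G_r, and let S ⊆ G be the union of the images of the S_i under the canonical inclusions of all the copies. Then the cogrowth series F = F_{G;S}(t) is algebraic: there exists a nonzero bivariate polynomial Λ(t,z) ∈ ℤ[t,z] with Λ(t, F(t)) = 0 as a formal power series, and with deg_t(Λ) ≤ (∏_{i=1}^r Δ_i)·(1 + Σ_{i=1}^r 1/Δ_i) and deg_z(Λ) ≤ (∏_{i=1}^r Δ_i)·(1 + Σ_{i=1}^r 1/Δ_i). In particular these degree bounds do not depend on m₁, …, m_r. -/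
/-- The cogrowth series `F_{G;S}(t) ∈ ℚ[[t]]`. -/
noncomputable def cogrowthSeries {G : Type*} [Group G] (S : Set G) : PowerSeries ℚ :=
  PowerSeries.mk fun n => (CL S n : ℚ)

namespace Cogrowth

open scoped PowerSeries

section WordCount

open scoped Classical in
/-- The number of words of length `n` over `S` with product `h`, counted by first letter. -/
noncomputable def wordCount {G : Type*} [Group G] (S : Finset G) : ℕ → G → ℕ
  | 0, h => if h = 1 then 1 else 0
  | n + 1, h => ∑ s ∈ S, wordCount S n (s⁻¹ * h)

variable {G : Type*} [Group G]

/-- Words of length `n + 1` with product `h`, split according to their first letter. -/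
def wordConsEquiv (S : Finset G) (n : ℕ) (h : G) :
    {w : Fin (n + 1) → G // (∀ i, w i ∈ S) ∧ (List.ofFn w).prod = h} ≃
      Σ s : S, {w : Fin n → G // (∀ i, w i ∈ S) ∧ (List.ofFn w).prod = (s : G)⁻¹ * h} where
  toFun w := ⟨⟨w.1 0, w.2.1 0⟩, ⟨fun i => w.1 i.succ, fun i => w.2.1 i.succ, by
    have := w.2.2
    rw [List.ofFn_succ, List.prod_cons] at this
    exact eq_inv_mul_of_mul_eq this⟩⟩
  invFun x := ⟨Fin.cons x.1.1 x.2.1, by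
    refine ⟨fun i => ?_, ?_⟩
    · refine Fin.cases ?_ (fun j => ?_) i
      · simp
      · simpa using x.2.2.1 j
    · simp [List.ofFn_succ, x.2.2.2]⟩
  left_inv w := by
    apply Subtype.ext
    exact Fin.cons_self_tail w.1
  right_inv x := by
    rcases x with ⟨⟨s, hs⟩, ⟨w, hw⟩⟩
    rfl

theorem finite_words (S : Finset G) (n : ℕ) (h : G) :
    Finite {w : Fin n → G // (∀ i, w i ∈ S) ∧ (List.ofFn w).prod = h} :=
  Finite.of_injective (fun w (i : Fin n) => (⟨w.1 i, w.2.1 i⟩ : S)) fun w w' hww => by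
    apply Subtype.ext
    funext i
    exact congrArg Subtype.val (congrFun hww i)

theorem card_words (S : Finset G) (n : ℕ) (h : G) :
    Nat.card {w : Fin n → G // (∀ i, w i ∈ S) ∧ (List.ofFn w).prod = h} = wordCount S n h := by
  induction n generalizing h with
  | zero =>
    rw [wordCount]
    split_ifs with hh
    · subst hh
      rw [Nat.card_eq_one_iff_unique]
      exact ⟨inferInstance, ⟨⟨Fin.elim0, fun i => i.elim0, by simp⟩⟩⟩
    · rw [Nat.card_eq_zero]
      left
      exact ⟨fun w => hh (by simpa using w.2.2.symm)⟩
  | succ n ih =>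
    have := fun s : S => finite_words S n ((s : G)⁻¹ * h)
    rw [Nat.card_congr (wordConsEquiv S n h), Nat.card_sigma, wordCount]
    simp only [ih]
    exact Finset.sum_coe_sort S fun s => wordCount S n (s⁻¹ * h)

theorem CL_eq_wordCount (S : Finset G) (n : ℕ) : CL (S : Set G) n = wordCount S n 1 := by
  rw [← card_words]
  rfl

/-- The generating series of the words over `S` with product `h`. -/
noncomputable def greenSeries (S : Finset G) (h : G) : ℤ⟦X⟧ :=
  PowerSeries.mk fun n => (wordCount S n h : ℤ)

open scoped Classical in
theorem greenSeries_eq (S : Finset G) (h : G) :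
    greenSeries S h
      = (if h = 1 then 1 else 0) + PowerSeries.X * ∑ s ∈ S, greenSeries S (s⁻¹ * h) := by
  ext n
  cases n with
  | zero =>
    simp [greenSeries, wordCount]
  | succ n =>
    rw [map_add, PowerSeries.coeff_succ_X_mul, map_sum]
    split_ifs <;> simp [greenSeries, wordCount, PowerSeries.coeff_one]

theorem greenSeries_one (S : Finset G) : greenSeries S 1 = cogrowthSeriesInt (S : Set G) := by
  ext n
  simp [greenSeries, cogrowthSeriesInt, CL_eq_wordCount]

theorem coeff_eq_wordCount {R : Type*} [CommRing R] [DecidableEq G] (S : Finset G) (Y : G → R⟦X⟧)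
    (hY : ∀ h, Y h = (if h = 1 then 1 else 0) + PowerSeries.X * ∑ s ∈ S, Y (s⁻¹ * h))
    (n : ℕ) (h : G) : PowerSeries.coeff n (Y h) = (wordCount S n h : R) := by
  induction n generalizing h with
  | zero =>
    rw [hY]
    simp only [wordCount]
    split_ifs <;> simp
  | succ n ih =>
    rw [hY, map_add, PowerSeries.coeff_succ_X_mul, map_sum]
    simp only [ih]
    split_ifs <;> simp [wordCount, PowerSeries.coeff_one]

end WordCount

section FixedPoint

theorem exists_fixedPoint {ι R : Type*} [CommRing R] (Φ : (ι → R⟦X⟧) → ι → R⟦X⟧)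
    (hΦ : ∀ n A B, (∀ i, (PowerSeries.X : R⟦X⟧) ^ n ∣ A i - B i) →
      ∀ i, (PowerSeries.X : R⟦X⟧) ^ (n + 1) ∣ Φ A i - Φ B i) :
    ∃ A, Φ A = A := by
  let A : ℕ → ι → R⟦X⟧ := fun n => Φ^[n] 0
  have hA : ∀ n, A (n + 1) = Φ (A n) := fun n => Function.iterate_succ_apply' Φ n 0
  have hstep : ∀ n i, (PowerSeries.X : R⟦X⟧) ^ n ∣ A (n + 1) i - A n i := by
    intro n
    induction n with
    | zero => simp
    | succ n ih =>
      rw [hA (n + 1), hA n]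
      rw [hA n] at ih
      exact hΦ n _ _ ih
  have hle : ∀ n k i, (PowerSeries.X : R⟦X⟧) ^ n ∣ A (n + k) i - A n i := by
    intro n k i
    induction k with
    | zero => simp
    | succ k ih =>
      have h2 := (pow_dvd_pow (PowerSeries.X : R⟦X⟧) (Nat.le_add_right n k)).trans
        (hstep (n + k) i)
      have := dvd_add h2 ih
      rwa [sub_add_sub_cancel] at this
  let L : ι → R⟦X⟧ := fun i => PowerSeries.mk fun n => PowerSeries.coeff n (A (n + 1) i)
  have hL : ∀ n i, (PowerSeries.X : R⟦X⟧) ^ n ∣ L i - A n i := by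
    intro n i
    rw [PowerSeries.X_pow_dvd_iff]
    intro k hk
    obtain ⟨j, rfl⟩ := Nat.exists_eq_add_of_le (Nat.succ_le_of_lt hk)
    have := PowerSeries.X_pow_dvd_iff.1 (hle (k + 1) j i) k (Nat.lt_succ_self k)
    rw [map_sub, sub_eq_zero] at this ⊢
    rw [PowerSeries.coeff_mk]
    exact this.symm
  refine ⟨L, funext fun i => ?_⟩
  ext n
  have h1 := PowerSeries.X_pow_dvd_iff.1 (hΦ n _ _ (hL n) i) n (Nat.lt_succ_self n)
  have h2 := PowerSeries.X_pow_dvd_iff.1 (hL (n + 1) i) n (Nat.lt_succ_self n)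
  rw [map_sub, sub_eq_zero] at h1 h2
  rw [h1, h2, hA]

theorem dvd_inv_sub_inv {K : Type*} [Field K] {d A B : K⟦X⟧}
    (hA : PowerSeries.constantCoeff A ≠ 0) (hB : PowerSeries.constantCoeff B ≠ 0)
    (h : d ∣ A - B) : d ∣ A⁻¹ - B⁻¹ := by
  have : A⁻¹ - B⁻¹ = -(A⁻¹ * B⁻¹) * (A - B) := by
    linear_combination B⁻¹ * PowerSeries.mul_inv_cancel A hA
      - A⁻¹ * PowerSeries.mul_inv_cancel B hB
  rw [this]
  exact h.mul_left _

theorem dvd_aeval_sub_aeval {R : Type*} [CommRing R] [Algebra ℤ R] {d a b : R} (P : Polynomial ℤ)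
    (h : d ∣ a - b) : d ∣ Polynomial.aeval a P - Polynomial.aeval b P := by
  rw [Polynomial.aeval_def, Polynomial.aeval_def, Polynomial.eval₂_eq_eval_map,
    Polynomial.eval₂_eq_eval_map]
  exact h.trans (Polynomial.sub_dvd_eval_sub _ _ _)

theorem constantCoeff_aeval_X_mul (P : Polynomial ℤ) (A : ℚ⟦X⟧) :
    PowerSeries.constantCoeff (Polynomial.aeval (PowerSeries.X * A) P) = (P.coeff 0 : ℚ) := by
  have := Polynomial.hom_eval₂ P (algebraMap ℤ ℚ⟦X⟧) (PowerSeries.constantCoeff (R := ℚ))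
    (PowerSeries.X * A)
  rw [Polynomial.aeval_def, this]
  simp [Polynomial.eval₂_at_zero]

/-- The power series system satisfied by the excursion series `E i` of a free product. -/
theorem exists_excursions {r : ℕ} (P Q : Fin r → Polynomial ℤ)
    (hP0 : ∀ i, (P i).coeff 0 = 1) (hQ0 : ∀ i, (Q i).coeff 0 = 1) (m : Fin r → ℚ) (c : ℚ) :
    ∃ (E κ : Fin r → ℚ⟦X⟧) (D : ℚ⟦X⟧), PowerSeries.constantCoeff D = 1 ∧
      (∀ i, (D + PowerSeries.X * κ i) * E i = 1) ∧
      (∀ i, Polynomial.aeval (PowerSeries.X * E i) (P i) * (1 - PowerSeries.X * E i * κ i)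
        = Polynomial.aeval (PowerSeries.X * E i) (Q i)) ∧
      D = 1 + PowerSeries.C c * PowerSeries.X
        - PowerSeries.X * ∑ i, PowerSeries.C (m i) * κ i := by
  let R : Fin r → Polynomial ℤ := fun i => (P i - Q i).divX
  have hR : ∀ i, P i - Q i = Polynomial.X * R i := fun i => by
    conv_lhs => rw [← Polynomial.X_mul_divX_add (P i - Q i)]
    simp [hP0, hQ0, R]
  let k : (Fin r → ℚ⟦X⟧) → Fin r → ℚ⟦X⟧ := fun A i =>
    Polynomial.aeval (PowerSeries.X * A i) (R i) *
      (Polynomial.aeval (PowerSeries.X * A i) (P i))⁻¹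
  have hPne : ∀ (A : ℚ⟦X⟧) i, PowerSeries.constantCoeff
      (Polynomial.aeval (PowerSeries.X * A) (P i)) ≠ 0 := fun A i => by
    rw [constantCoeff_aeval_X_mul, hP0]
    simp
  let D : (Fin r → ℚ⟦X⟧) → ℚ⟦X⟧ := fun A => 1 + PowerSeries.C c * PowerSeries.X
        - PowerSeries.X * ∑ i, PowerSeries.C (m i) * k A i
  have hD : ∀ A, PowerSeries.constantCoeff (D A) = 1 := fun A => by simp [D]
  have hDk : ∀ A i, PowerSeries.constantCoeff (D A + PowerSeries.X * k A i) ≠ 0 :=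
    fun A i => by simp [hD]
  have hk : ∀ n A B, (∀ i, (PowerSeries.X : ℚ⟦X⟧) ^ n ∣ A i - B i) →
      ∀ i, (PowerSeries.X : ℚ⟦X⟧) ^ n ∣ k A i - k B i := by
    intro n A B hAB i
    have hX : (PowerSeries.X : ℚ⟦X⟧) ^ n ∣ PowerSeries.X * A i - PowerSeries.X * B i := by
      rw [← mul_sub]
      exact (hAB i).mul_left _
    have h1 := dvd_aeval_sub_aeval (R i) hX
    have h2 := dvd_inv_sub_inv (hPne (A i) i) (hPne (B i) i) (dvd_aeval_sub_aeval (P i) hX)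
    simp only [k]
    exact dvd_mul_sub_mul h1 h2
  obtain ⟨E, hE⟩ := exists_fixedPoint (fun A i => (D A + PowerSeries.X * k A i)⁻¹) (by
    intro n A B hAB i
    refine dvd_inv_sub_inv (hDk A i) (hDk B i) ?_
    have h1 : (PowerSeries.X : ℚ⟦X⟧) ^ n ∣
        (k A i - k B i) - ∑ i, PowerSeries.C (m i) * (k A i - k B i) :=
      dvd_sub (hk n A B hAB i)
        (Finset.dvd_sum fun j _ => (hk n A B hAB j).mul_left _)
    have h2 : D A + PowerSeries.X * k A i - (D B + PowerSeries.X * k B i)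
        = PowerSeries.X * ((k A i - k B i) - ∑ i, PowerSeries.C (m i) * (k A i - k B i)) := by
      simp only [D, mul_sub, Finset.sum_sub_distrib]
      ring
    rw [h2, pow_succ']
    exact mul_dvd_mul_left _ h1)
  have hEi : ∀ i, (D E + PowerSeries.X * k E i) * E i = 1 := fun i => by
    have h : (D E + PowerSeries.X * k E i)⁻¹ = E i := congrFun hE i
    rw [← PowerSeries.mul_inv_cancel _ (hDk E i), h]
  refine ⟨E, k E, D E, hD E, hEi, fun i => ?_, rfl⟩
  have h1 := PowerSeries.mul_inv_cancel _ (hPne (E i) i)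
  have h2 := congrArg (Polynomial.aeval (PowerSeries.X * E i)) (hR i)
  rw [map_sub, map_mul, Polynomial.aeval_X] at h2
  simp only [k]
  linear_combination h2 - (PowerSeries.X * E i * Polynomial.aeval (PowerSeries.X * E i) (R i)) * h1

end FixedPoint

section FreeProduct

open scoped Classical in
/-- The normalized Green function of a group along a power series `X * E`. -/
theorem exists_normalized_green {G : Type*} [Group G] (S : Finset G) (P Q : Polynomial ℤ)
    (hP0 : P.coeff 0 = 1)
    (hPQ : (Q : ℤ⟦X⟧) * cogrowthSeriesInt (S : Set G) = (P : ℤ⟦X⟧)) {E κ D : ℚ⟦X⟧}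
    (hE : (D + PowerSeries.X * κ) * E = 1)
    (hPE : Polynomial.aeval (PowerSeries.X * E) P * (1 - PowerSeries.X * E * κ)
      = Polynomial.aeval (PowerSeries.X * E) Q) :
    ∃ γ : G → ℚ⟦X⟧, γ 1 = 1 ∧ ∀ k, PowerSeries.X * ∑ s ∈ S, γ (s⁻¹ * k)
      = (D + PowerSeries.X * κ) * γ k - if k = 1 then D else 0 := by
  have hs : PowerSeries.HasSubst (PowerSeries.X * E : ℚ⟦X⟧) :=
    PowerSeries.HasSubst.of_constantCoeff_zero' (by simp)
  let φ : ℤ⟦X⟧ →ₐ[ℤ] ℚ⟦X⟧ := PowerSeries.substAlgHom hs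
  have hφX : φ PowerSeries.X = PowerSeries.X * E := PowerSeries.substAlgHom_X hs
  have hφp : ∀ p : Polynomial ℤ, φ (p : ℤ⟦X⟧) = Polynomial.aeval (PowerSeries.X * E) p :=
    fun p => PowerSeries.substAlgHom_coe hs p
  let g : G → ℚ⟦X⟧ := fun k => φ (greenSeries S k)
  have hg : ∀ k, g k = (if k = 1 then 1 else 0)
      + PowerSeries.X * E * ∑ s ∈ S, g (s⁻¹ * k) := by
    intro k
    have h := congrArg φ (greenSeries_eq S k)
    rw [map_add, map_mul, hφX, map_sum, apply_ite φ, map_one, map_zero] at h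
    exact h
  have hP : Polynomial.aeval (PowerSeries.X * E) P ≠ 0 := fun h => by
    have h0 := constantCoeff_aeval_X_mul P E
    rw [h, hP0] at h0
    simp at h0
  have hg1 : g 1 * (E * D) = 1 := by
    have h := congrArg φ hPQ
    rw [map_mul, hφp, hφp, ← greenSeries_one] at h
    have h1 : Polynomial.aeval (PowerSeries.X * E) P * (g 1 * (E * D))
        = Polynomial.aeval (PowerSeries.X * E) P * 1 := by
      simp only [g]
      linear_combination h + φ (greenSeries S 1) * hPE
        + Polynomial.aeval (PowerSeries.X * E) P * φ (greenSeries S 1) * hE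
    exact mul_left_cancel₀ hP h1
  refine ⟨fun k => g k * (E * D), hg1, fun k => ?_⟩
  rw [← Finset.sum_mul]
  have h := hg k
  split_ifs at h ⊢ with hk
  · linear_combination (-D) * h - g k * D * hE
  · linear_combination (-D) * h - g k * D * hE

open Monoid

variable {ι : Type*} {H : ι → Type*} [∀ p, Group (H p)]

open scoped Classical in
/-- The multiplicative extension to the free product of functions on the factors. -/
noncomputable def extendByLetters {R : Type*} [CommRing R] (γ : ∀ p, H p → R)
    (w : CoprodI.Word H) : R :=
  (w.toList.map fun l => γ l.1 l.2).prod

open scoped Classical in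
theorem extendByLetters_of_mul {R : Type*} [CommRing R] (γ : ∀ p, H p → R)
    (hγ : ∀ p, γ p 1 = 1) {p : ι} (k : H p) (w : CoprodI.Word H) (hw : w.fstIdx ≠ some p) :
    extendByLetters γ (CoprodI.Word.equiv (CoprodI.of k * w.prod))
      = γ p k * extendByLetters γ w := by
  have h : CoprodI.Word.equiv (CoprodI.of k * w.prod)
      = CoprodI.Word.rcons (⟨k, w, hw⟩ : CoprodI.Word.Pair H p) := by
    rw [← Equiv.eq_symm_apply]
    exact (CoprodI.Word.prod_rcons (⟨k, w, hw⟩ : CoprodI.Word.Pair H p)).symm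
  rw [h, CoprodI.Word.rcons]
  split_ifs with hk
  · simp only at hk
    rw [hk, hγ, one_mul]
  · simp [extendByLetters, CoprodI.Word.cons]

open scoped Classical in
theorem sum_extendByLetters {R : Type*} [CommRing R] (γ : ∀ p, H p → R)
    (hγ : ∀ p, γ p 1 = 1) (S : ∀ p, Finset (H p)) (x D : R) (ε : ι → R)
    (h : ∀ p k, x * ∑ s ∈ S p, γ p (s⁻¹ * k) = ε p * γ p k - if k = 1 then D else 0)
    (p : ι) (g : CoprodI H) :
    x * ∑ s ∈ S p, extendByLetters γ (CoprodI.Word.equiv ((CoprodI.of s)⁻¹ * g))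
      = (ε p - if (CoprodI.Word.equiv g).fstIdx = some p then 0 else D)
        * extendByLetters γ (CoprodI.Word.equiv g) := by
  obtain ⟨⟨k, w, hw⟩, hkw⟩ : ∃ P : CoprodI.Word.Pair H p, CoprodI.Word.rcons P
      = CoprodI.Word.equiv g :=
    ⟨CoprodI.Word.equivPair p (CoprodI.Word.equiv g), (CoprodI.Word.equivPair p).symm_apply_apply _⟩
  have hg : g = CoprodI.of k * w.prod := by
    rw [← CoprodI.Word.prod_rcons (⟨k, w, hw⟩ : CoprodI.Word.Pair H p), hkw]
    exact (CoprodI.Word.equiv.symm_apply_apply g).symm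
  have hfst : (CoprodI.Word.equiv g).fstIdx = some p ↔ k ≠ 1 := by
    rw [← hkw, CoprodI.Word.rcons]
    split_ifs with hk
    · exact iff_of_false hw (not_not.2 hk)
    · exact iff_of_true (by simp) hk
  have hs : ∀ s ∈ S p, extendByLetters γ (CoprodI.Word.equiv ((CoprodI.of s)⁻¹ * g))
      = γ p (s⁻¹ * k) * extendByLetters γ w := fun s _ => by
    rw [hg, ← mul_assoc, ← map_inv, ← map_mul, extendByLetters_of_mul γ hγ _ w hw]
  rw [Finset.sum_congr rfl hs, ← Finset.sum_mul, ← mul_assoc, h, if_congr hfst rfl rfl]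
  rw [hg, extendByLetters_of_mul γ hγ k w hw]
  by_cases hk : k = 1
  · simp [hk, hγ]
  · simp [hk]
    ring

open scoped Classical in
theorem sum_fstIdx {R : Type*} [CommRing R] [Fintype ι] (D : R) (g : CoprodI H) :
    ∑ p, (if (CoprodI.Word.equiv g).fstIdx = some p then 0 else D)
      = (Fintype.card ι - 1 : R) * D + if g = 1 then D else 0 := by
  have h1 : ∀ p, (if (CoprodI.Word.equiv g).fstIdx = some p then 0 else D)
      = D - if (CoprodI.Word.equiv g).fstIdx = some p then D else 0 := fun p => by
    split_ifs <;> simp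
  simp only [h1, Finset.sum_sub_distrib, Finset.sum_const, Finset.card_univ, nsmul_eq_mul]
  have h2 : g = 1 ↔ (CoprodI.Word.equiv g).fstIdx = none := by
    have h3 : (CoprodI.Word.equiv (1 : CoprodI H)) = CoprodI.Word.empty := by
      rw [← Equiv.eq_symm_apply]
      rfl
    constructor
    · rintro rfl
      rw [h3]
      rfl
    · intro h
      rw [← CoprodI.Word.equiv.apply_eq_iff_eq, h3]
      apply CoprodI.Word.ext
      simpa [CoprodI.Word.fstIdx] using h
  cases hf : (CoprodI.Word.equiv g).fstIdx with
  | none =>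
    rw [if_pos (h2.2 hf)]
    simp
    ring
  | some p =>
    rw [if_neg (fun h => by simp [h2.1 h] at hf)]
    simp
    ring

theorem of_eq_of_imp {p q : ι} (hpq : p ≠ q) {a : H p} {b : H q}
    (h : (CoprodI.of a : CoprodI H) = CoprodI.of b) : b = 1 := by
  classical
  have := congrArg (CoprodI.lift (Pi.mulSingle q (MonoidHom.id (H q)))) h
  simpa [CoprodI.lift_of, Pi.mulSingle_eq_of_ne hpq] using this.symm

theorem sum_eq_sum_erase_add {α R : Type*} [DecidableEq α] [CommRing R] (A : Finset α) (a : α)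
    (f : α → R) : ∑ s ∈ A, f s = ∑ s ∈ A.erase a, f s + if a ∈ A then f a else 0 := by
  split_ifs with h
  · exact (Finset.sum_erase_add _ _ h).symm
  · rw [Finset.erase_eq_of_notMem h, add_zero]

open scoped Classical in
/-- The union of the images of the `S p` in the free product. -/
noncomputable def unionOf [Fintype ι] (S : ∀ p, Finset (H p)) : Finset (CoprodI H) :=
  Finset.univ.biUnion fun p => (S p).image CoprodI.of

theorem coe_unionOf [Fintype ι] (S : ∀ p, Finset (H p)) :
    (unionOf S : Set (CoprodI H)) = ⋃ p, CoprodI.of '' (S p : Set (H p)) := by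
  simp [unionOf]

theorem exists_sum_unionOf (R : Type*) [CommRing R] [Fintype ι] (S : ∀ p, Finset (H p)) :
    ∃ c : ℤ, ∀ f : CoprodI H → R,
      ∑ s ∈ unionOf S, f s = ∑ p, ∑ s ∈ S p, f (CoprodI.of s) - c * f 1 := by
  classical
  refine ⟨(∑ p, if 1 ∈ S p then 1 else 0) - if 1 ∈ unionOf S then 1 else 0, fun f => ?_⟩
  have herase : (unionOf S).erase 1
      = Finset.univ.biUnion fun p => ((S p).erase 1).image (CoprodI.of : H p → CoprodI H) := by
    ext g
    simp only [unionOf, Finset.mem_erase, Finset.mem_biUnion, Finset.mem_univ, true_and,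
      Finset.mem_image]
    constructor
    · rintro ⟨h1, p, a, ha, rfl⟩
      exact ⟨p, a, ⟨fun h => h1 (by rw [h, map_one]), ha⟩, rfl⟩
    · rintro ⟨p, a, ⟨h1, ha⟩, rfl⟩
      exact ⟨fun h => h1 (CoprodI.of_injective p (by rw [h, map_one])), p, a, ha, rfl⟩
  have hsum : ∑ s ∈ (unionOf S).erase 1, f s = ∑ p, ∑ s ∈ (S p).erase 1, f (CoprodI.of s) := by
    rw [herase, Finset.sum_biUnion]
    · refine Finset.sum_congr rfl fun p _ => Finset.sum_image fun a _ b _ h => ?_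
      exact CoprodI.of_injective p h
    · intro p _ q _ hpq
      rw [Function.onFun, Finset.disjoint_left]
      intro g hg hg'
      obtain ⟨a, ha, rfl⟩ := Finset.mem_image.1 hg
      obtain ⟨b, hb, hab⟩ := Finset.mem_image.1 hg'
      exact (Finset.mem_erase.1 hb).1 (of_eq_of_imp hpq hab.symm)
  rw [sum_eq_sum_erase_add _ 1, hsum]
  have hp : ∀ p, ∑ s ∈ S p, f (CoprodI.of s) = ∑ s ∈ (S p).erase 1, f (CoprodI.of s)
      + (if 1 ∈ S p then 1 else 0) * f 1 := fun p => by
    rw [sum_eq_sum_erase_add (S p) 1]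
    simp
  rw [Finset.sum_congr rfl fun p _ => hp p, Finset.sum_add_distrib, ← Finset.sum_mul]
  push_cast
  split_ifs <;> ring

open scoped Classical in
theorem cogrowthSeries_unionOf_mul [Fintype ι] (S : ∀ p, Finset (H p)) {c : ℤ}
    (hc : ∀ f : CoprodI H → ℚ⟦X⟧,
      ∑ s ∈ unionOf S, f s = ∑ p, ∑ s ∈ S p, f (CoprodI.of s) - c * f 1)
    (γ : ∀ p, H p → ℚ⟦X⟧) (hγ : ∀ p, γ p 1 = 1) (κ : ι → ℚ⟦X⟧) {D : ℚ⟦X⟧}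
    (hD : PowerSeries.constantCoeff D = 1)
    (h : ∀ p k, PowerSeries.X * ∑ s ∈ S p, γ p (s⁻¹ * k)
      = (D + PowerSeries.X * κ p) * γ p k - if k = 1 then D else 0)
    (hDκ : D = 1 + (c : ℚ⟦X⟧) * PowerSeries.X - PowerSeries.X * ∑ p, κ p) :
    cogrowthSeries (unionOf S : Set (CoprodI H)) * D = 1 := by
  have hDinv : D⁻¹ * D = 1 := PowerSeries.inv_mul_cancel D (by simp [hD])
  have hone : extendByLetters γ (CoprodI.Word.equiv (1 : CoprodI H)) = 1 := by
    have h3 : (CoprodI.Word.equiv (1 : CoprodI H)) = CoprodI.Word.empty := by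
      rw [← Equiv.eq_symm_apply]
      rfl
    simp [h3, extendByLetters]
  have hY : ∀ g, D⁻¹ * extendByLetters γ (CoprodI.Word.equiv g) = (if g = 1 then 1 else 0)
      + PowerSeries.X * ∑ s ∈ unionOf S,
        D⁻¹ * extendByLetters γ (CoprodI.Word.equiv (s⁻¹ * g)) := by
    intro g
    rw [← Finset.mul_sum, hc, inv_one, one_mul, mul_left_comm, mul_sub, Finset.mul_sum,
      Finset.sum_congr rfl fun p _ => sum_extendByLetters γ hγ S _ D _ h p g,
      ← Finset.sum_mul, Finset.sum_sub_distrib, sum_fstIdx, Finset.sum_add_distrib,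
      ← Finset.mul_sum, Finset.sum_const, Finset.card_univ, nsmul_eq_mul]
    split_ifs with hg
    · subst hg
      rw [hone]
      linear_combination (-D⁻¹) * hDκ + hDinv
    · linear_combination (-D⁻¹) * extendByLetters γ (CoprodI.Word.equiv g) * hDκ
  have hF : cogrowthSeries (unionOf S : Set (CoprodI H)) = D⁻¹ := by
    ext n
    have := coeff_eq_wordCount (unionOf S) _ hY n 1
    rw [hone, mul_one] at this
    rw [this, cogrowthSeries, PowerSeries.coeff_mk, CL_eq_wordCount]
  rw [hF, hDinv]

end FreeProduct

section Elimination

/-- The companion matrix of the monic polynomial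
`∑ k ≤ d, q_k z ^ k y ^ (d - k) - ∑ k < d, p_k z ^ k y ^ (d - 1 - k)` in `y`. -/
def companionEntry {A : Type*} [CommRing A] (z : A) (P Q : Polynomial ℤ) {d : ℕ}
    (a j : Fin d) : A :=
  if (a : ℕ) + 1 < d then (if (j : ℕ) = a + 1 then 1 else 0)
  else (P.coeff (d - 1 - j) : A) * z ^ (d - 1 - (j : ℕ))
    - (Q.coeff (d - 1 - j + 1) : A) * z ^ (d - 1 - (j : ℕ) + 1)

theorem map_companionEntry {A B : Type*} [CommRing A] [CommRing B] (f : A →+* B) (z : A)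
    (P Q : Polynomial ℤ) {d : ℕ} (a j : Fin d) :
    f (companionEntry z P Q a j) = companionEntry (f z) P Q a j := by
  unfold companionEntry
  split_ifs <;> simp

theorem aeval_mul_pow {A : Type*} [CommRing A] [Algebra ℤ A] {u y z : A} (huy : u * y = z)
    {P : Polynomial ℤ} {n : ℕ} (hP : P.natDegree ≤ n) :
    Polynomial.aeval u P * y ^ n
      = ∑ k ∈ Finset.range (n + 1), (P.coeff k : A) * z ^ k * y ^ (n - k) := by
  rw [Polynomial.aeval_eq_sum_range' (Nat.lt_succ_of_le hP), Finset.sum_mul]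
  refine Finset.sum_congr rfl fun k hk => ?_
  have hkn : k ≤ n := Nat.lt_succ_iff.1 (Finset.mem_range.1 hk)
  have hy : y ^ n = y ^ k * y ^ (n - k) := by rw [← pow_add, Nat.add_sub_cancel' hkn]
  rw [Algebra.smul_def, eq_intCast, hy, ← huy, mul_pow]
  ring

theorem pow_succ_eq_sum_companionEntry {A : Type*} [CommRing A] [Algebra ℤ A] {u y z : A}
    (huy : u * y = z) {P Q : Polynomial ℤ}
    (hPQ : y * Polynomial.aeval u Q = Polynomial.aeval u P) (hQ0 : Q.coeff 0 = 1) {d : ℕ}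
    (hP : P.natDegree + 1 ≤ d) (hQ : Q.natDegree ≤ d) (a : Fin d) :
    ∑ j, companionEntry z P Q a j * y ^ (j : ℕ) = y ^ ((a : ℕ) + 1) := by
  unfold companionEntry
  split_ifs with ha
  · rw [Finset.sum_eq_single (⟨a + 1, ha⟩ : Fin d)]
    · simp
    · intro j _ hj
      rw [if_neg fun h => hj (Fin.ext h), zero_mul]
    · simp
  · obtain ⟨n, rfl⟩ : ∃ n, d = n + 1 := ⟨d - 1, by omega⟩
    have han : (a : ℕ) = n := by omega
    have h1 := aeval_mul_pow huy (Nat.le_of_succ_le_succ hP)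
    have h2 := aeval_mul_pow huy hQ
    rw [Finset.sum_range_succ'] at h2
    simp only [hQ0, Int.cast_one, pow_zero, mul_one, one_mul, Nat.sub_zero,
      Nat.add_sub_add_right] at h2
    have h3 := Fin.sum_univ_eq_sum_range (fun j => ((P.coeff (n - j) : A) * z ^ (n - j)
      - (Q.coeff (n - j + 1) : A) * z ^ (n - j + 1)) * y ^ j) (n + 1)
    simp only [Nat.add_sub_cancel]
    rw [h3, ← Finset.sum_range_reflect, han]
    have h4 : ∀ k ∈ Finset.range (n + 1),
        ((P.coeff (n - (n + 1 - 1 - k)) : A) * z ^ (n - (n + 1 - 1 - k))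
          - (Q.coeff (n - (n + 1 - 1 - k) + 1) : A) * z ^ (n - (n + 1 - 1 - k) + 1))
            * y ^ (n + 1 - 1 - k)
        = (P.coeff k : A) * z ^ k * y ^ (n - k)
          - (Q.coeff (k + 1) : A) * z ^ (k + 1) * y ^ (n - k) := fun k hk => by
      have : n - (n + 1 - 1 - k) = k := by
        have := Finset.mem_range.1 hk
        omega
      rw [this, Nat.add_sub_cancel]
      ring
    rw [Finset.sum_congr rfl h4, Finset.sum_sub_distrib, ← h1]
    linear_combination (-y ^ n) * hPQ + h2

variable {ι : Type*} [Fintype ι] [DecidableEq ι]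

/-- A matrix with eigenvalue `∑ i, m i * y i + b + c * z` whenever each `y i` is an eigenvalue of
the corresponding companion matrix. -/
def kroneckerSum {A : Type*} [CommRing A] (z : A) (P Q : ι → Polynomial ℤ) (d : ι → ℕ)
    (m : ι → ℤ) (b c : ℤ) : Matrix (∀ i, Fin (d i)) (∀ i, Fin (d i)) A := fun J J' =>
  (∑ i, (m i : A) * ∑ j, if J' = Function.update J i j then
    companionEntry z (P i) (Q i) (J i) j else 0) + if J' = J then (b : A) + c * z else 0

theorem map_kroneckerSum {A B : Type*} [CommRing A] [CommRing B] (f : A →+* B) (z : A)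
    (P Q : ι → Polynomial ℤ) (d : ι → ℕ) (m : ι → ℤ) (b c : ℤ) :
    (kroneckerSum z P Q d m b c).map f = kroneckerSum (f z) P Q d m b c := by
  ext J J'
  simp [kroneckerSum, apply_ite f, map_companionEntry]

theorem kroneckerSum_mulVec {A : Type*} [CommRing A] (z : A) (P Q : ι → Polynomial ℤ)
    (d : ι → ℕ) (m : ι → ℤ) (b c : ℤ) (y : ι → A)
    (hy : ∀ i (a : Fin (d i)), ∑ j, companionEntry z (P i) (Q i) a j * y i ^ (j : ℕ)
      = y i ^ ((a : ℕ) + 1)) :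
    (kroneckerSum z P Q d m b c).mulVec (fun J => ∏ i, y i ^ (J i : ℕ))
      = (∑ i, m i * y i + b + c * z) • fun J => ∏ i, y i ^ (J i : ℕ) := by
  ext J
  have hupd : ∀ i j, ∏ k, y k ^ (Function.update J i j k : ℕ)
      = y i ^ (j : ℕ) * ∏ k ∈ Finset.univ.erase i, y k ^ (J k : ℕ) := fun i j => by
    rw [← Finset.mul_prod_erase _ _ (Finset.mem_univ i), Function.update_self]
    congr 1
    refine Finset.prod_congr rfl fun k hk => ?_
    rw [Function.update_of_ne (Finset.ne_of_mem_erase hk)]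
  have hi : ∀ i, ∑ J', (∑ j, if J' = Function.update J i j then
      companionEntry z (P i) (Q i) (J i) j else 0) * ∏ k, y k ^ (J' k : ℕ)
      = y i * ∏ k, y k ^ (J k : ℕ) := fun i => by
    simp only [Finset.sum_mul, ite_mul, zero_mul]
    rw [Finset.sum_comm]
    simp only [Finset.sum_ite_eq', Finset.mem_univ, if_true, hupd, ← mul_assoc]
    rw [← Finset.sum_mul, hy, ← Finset.mul_prod_erase _ _ (Finset.mem_univ i)]
    ring
  simp only [Matrix.mulVec, dotProduct, kroneckerSum, add_mul, Finset.sum_add_distrib,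
    Pi.smul_apply, smul_eq_mul, ite_mul, zero_mul, Finset.sum_ite_eq',
    Finset.mem_univ, if_true]
  have : ∑ J', (∑ i, (m i : A) * ∑ j, if J' = Function.update J i j then
      companionEntry z (P i) (Q i) (J i) j else 0) * ∏ k, y k ^ (J' k : ℕ)
      = (∑ i, m i * y i) * ∏ k, y k ^ (J k : ℕ) := by
    simp only [Finset.sum_mul]
    rw [Finset.sum_comm]
    refine Finset.sum_congr rfl fun i _ => ?_
    simp only [mul_assoc, ← Finset.mul_sum]
    rw [hi]
  rw [this]
  ring

/-- The polynomial in `t = X 0` and `F = X 1` obtained by eliminating the `y i`. -/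
noncomputable def eliminant (P Q : ι → Polynomial ℤ) (d : ι → ℕ) (m : ι → ℤ) (b c : ℤ) :
    MvPolynomial (Fin 2) ℤ :=
  Matrix.det (Matrix.scalar (∀ i, Fin (d i)) (MvPolynomial.X 1)
    - kroneckerSum (MvPolynomial.X 0 * MvPolynomial.X 1) P Q d m b c)

theorem map_eliminant {A : Type*} [CommRing A] (f : MvPolynomial (Fin 2) ℤ →+* A)
    (P Q : ι → Polynomial ℤ) (d : ι → ℕ) (m : ι → ℤ) (b c : ℤ) :
    f (eliminant P Q d m b c)
      = Matrix.det (Matrix.scalar (∀ i, Fin (d i)) (f (MvPolynomial.X 1))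
        - kroneckerSum (f (MvPolynomial.X 0) * f (MvPolynomial.X 1)) P Q d m b c) := by
  rw [eliminant, RingHom.map_det, map_sub, RingHom.mapMatrix_apply, RingHom.mapMatrix_apply,
    map_kroneckerSum, map_mul]
  congr 2
  ext J J'
  simp [Matrix.diagonal_apply, apply_ite f]

theorem eliminant_ne_zero (P Q : ι → Polynomial ℤ) (d : ι → ℕ) (m : ι → ℤ) (b c : ℤ) :
    eliminant P Q d m b c ≠ 0 := by
  intro h
  have h1 := map_eliminant (MvPolynomial.aeval ![(0 : Polynomial ℤ), Polynomial.X]).toRingHom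
    P Q d m b c
  have h2 : Matrix.det (Matrix.scalar (∀ i, Fin (d i)) Polynomial.X
      - kroneckerSum (0 : Polynomial ℤ) P Q d m b c)
      = (kroneckerSum (0 : ℤ) P Q d m b c).charpoly := by
    rw [Matrix.charpoly, Matrix.charmatrix, RingHom.mapMatrix_apply, map_kroneckerSum, map_zero]
  rw [h, map_zero] at h1
  simp only [AlgHom.toRingHom_eq_coe, RingHom.coe_coe, MvPolynomial.aeval_X,
    Matrix.cons_val_zero, Matrix.cons_val_one, zero_mul] at h1
  rw [h2] at h1
  exact (Matrix.charpoly_monic _).ne_zero h1.symm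

theorem map_eliminant_eq_zero {A : Type*} [CommRing A] [IsDomain A]
    (f : MvPolynomial (Fin 2) ℤ →+* A) (P Q : ι → Polynomial ℤ) (d : ι → ℕ)
    (hd : ∀ i, 0 < d i) (m : ι → ℤ) (b c : ℤ) (y : ι → A) {z : A}
    (hz : f (MvPolynomial.X 0) * f (MvPolynomial.X 1) = z)
    (hy : ∀ i (a : Fin (d i)), ∑ j, companionEntry z (P i) (Q i) a j * y i ^ (j : ℕ)
      = y i ^ ((a : ℕ) + 1))
    (hF : f (MvPolynomial.X 1) = ∑ i, m i * y i + b + c * z) :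
    f (eliminant P Q d m b c) = 0 := by
  rw [map_eliminant, hz]
  refine Matrix.exists_mulVec_eq_zero_iff.1 ⟨fun J => ∏ i, y i ^ (J i : ℕ), fun h => ?_, ?_⟩
  · have := congrFun h fun i => ⟨0, hd i⟩
    simp at this
  · rw [Matrix.sub_mulVec, kroneckerSum_mulVec z P Q d m b c y hy, hF, Matrix.scalar_apply,
      ← Matrix.smul_one_eq_diagonal, Matrix.smul_mulVec, Matrix.one_mulVec, sub_self]

end Elimination

section Degree

theorem degreeOf_det_le {σ n R : Type*} [CommRing R] [Fintype n] [DecidableEq n]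
    (A : Matrix n n (MvPolynomial σ R)) (v : σ) (wt : n → ℕ)
    (h : ∀ a b, A a b ≠ 0 → (A a b).degreeOf v + wt b ≤ wt a + 1) :
    A.det.degreeOf v ≤ Fintype.card n := by
  rw [Matrix.det_apply]
  refine (MvPolynomial.degreeOf_sum_le v _ _).trans (Finset.sup_le fun τ _ => ?_)
  have hprod : (∏ i, A (τ i) i).degreeOf v ≤ Fintype.card n := by
    by_cases h0 : ∃ i, A (τ i) i = 0
    · obtain ⟨i, hi⟩ := h0
      have h1 : ∏ i, A (τ i) i = 0 := Finset.prod_eq_zero (Finset.mem_univ i) hi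
      rw [h1, MvPolynomial.degreeOf_zero]
      exact Nat.zero_le _
    · push Not at h0
      have h1 := Finset.sum_le_sum fun i (_ : i ∈ Finset.univ) => h (τ i) i (h0 i)
      rw [Finset.sum_add_distrib, Finset.sum_add_distrib, Equiv.sum_comp τ wt, add_comm,
        add_le_add_iff_left] at h1
      refine (MvPolynomial.degreeOf_prod_le v _ _).trans (h1.trans ?_)
      simp
  rcases Int.units_eq_one_or (Equiv.Perm.sign τ) with hs | hs
  · rwa [hs, one_smul]
  · rw [hs, Units.neg_smul, one_smul]
    have : -(∏ i, A (τ i) i) = MvPolynomial.C (-1) * ∏ i, A (τ i) i := by simp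
    rw [this]
    exact (MvPolynomial.degreeOf_C_mul_le _ _ _).trans hprod

/-- The polynomials of degree at most `e - e'` in `v`, only `0` being allowed if `e < e'`. -/
def degreeSubmodule {σ : Type*} (v : σ) (e e' : ℕ) : AddSubgroup (MvPolynomial σ ℤ) where
  carrier := {p | p ≠ 0 → p.degreeOf v + e' ≤ e}
  zero_mem' h := absurd rfl h
  add_mem' {p q} hp hq hpq := by
    by_cases h1 : p = 0
    · subst h1
      rw [zero_add] at hpq ⊢
      exact hq hpq
    by_cases h2 : q = 0
    · subst h2
      rw [add_zero] at hpq ⊢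
      exact hp hpq
    have h3 := hp h1
    have h4 := hq h2
    have := MvPolynomial.degreeOf_add_le v p q
    omega
  neg_mem' {p} hp hpq := by
    have : -p = MvPolynomial.C (-1) * p := by simp
    have h2 := MvPolynomial.degreeOf_C_mul_le p v (-1)
    rw [← this] at h2
    have h3 := hp (neg_ne_zero.1 hpq)
    omega

theorem intCast_mul_mem {σ : Type*} {v : σ} {e e' : ℕ} {p : MvPolynomial σ ℤ} (n : ℤ)
    (hp : p ∈ degreeSubmodule v e e') : (n : MvPolynomial σ ℤ) * p ∈ degreeSubmodule v e e' := by
  rw [← zsmul_eq_mul]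
  exact AddSubgroup.zsmul_mem _ hp n

theorem degreeOf_X_mul_X_pow_le (v : Fin 2) (k : ℕ) :
    ((MvPolynomial.X 0 * MvPolynomial.X 1 : MvPolynomial (Fin 2) ℤ) ^ k).degreeOf v ≤ k := by
  refine (MvPolynomial.degreeOf_pow_le v _ k).trans ?_
  have : (MvPolynomial.X 0 * MvPolynomial.X 1 : MvPolynomial (Fin 2) ℤ).degreeOf v ≤ 1 := by
    refine (MvPolynomial.degreeOf_mul_le v _ _).trans ?_
    rw [MvPolynomial.degreeOf_X, MvPolynomial.degreeOf_X]
    fin_cases v <;> simp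
  exact (Nat.mul_le_mul_left k this).trans (by simp)

theorem companionEntry_mem (v : Fin 2) (P Q : Polynomial ℤ) {d : ℕ} (a j : Fin d) :
    companionEntry (MvPolynomial.X 0 * MvPolynomial.X 1 : MvPolynomial (Fin 2) ℤ) P Q a j
      ∈ degreeSubmodule v (a + 1) j := by
  have ha := a.2
  have hj := j.2
  unfold companionEntry
  split_ifs with h1 h2
  · intro _
    rw [MvPolynomial.degreeOf_one]
    omega
  · exact zero_mem _
  · refine sub_mem (intCast_mul_mem _ fun _ => ?_) (intCast_mul_mem _ fun _ => ?_)
    · have := degreeOf_X_mul_X_pow_le v (d - 1 - (j : ℕ))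
      omega
    · have := degreeOf_X_mul_X_pow_le v (d - 1 - (j : ℕ) + 1)
      omega

variable {ι : Type*} [Fintype ι] [DecidableEq ι]

theorem degreeOf_eliminant_le (v : Fin 2) (P Q : ι → Polynomial ℤ) (d : ι → ℕ) (m : ι → ℤ)
    (b c : ℤ) : (eliminant P Q d m b c).degreeOf v ≤ ∏ i, d i := by
  refine (degreeOf_det_le _ v (fun J => ∑ i, (J i : ℕ)) fun J J' => ?_).trans (by simp)
  suffices h : (Matrix.scalar (∀ i, Fin (d i)) (MvPolynomial.X 1)
      - kroneckerSum (MvPolynomial.X 0 * MvPolynomial.X 1) P Q d m b c :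
        Matrix _ _ (MvPolynomial (Fin 2) ℤ)) J J'
      ∈ degreeSubmodule v (∑ i, (J i : ℕ) + 1) (∑ i, (J' i : ℕ)) from h
  rw [Matrix.sub_apply, Matrix.scalar_apply, Matrix.diagonal_apply, kroneckerSum]
  refine sub_mem ?_ (add_mem (sum_mem fun i _ => intCast_mul_mem _ (sum_mem fun j _ => ?_)) ?_)
  · split_ifs with h
    · subst h
      intro _
      rw [MvPolynomial.degreeOf_X]
      split_ifs <;> omega
    · exact zero_mem _
  · split_ifs with h
    · intro h0
      have h1 := companionEntry_mem v (P i) (Q i) (J i) j h0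
      have h2 : ∑ k, (J' k : ℕ) + J i = ∑ k, (J k : ℕ) + j := by
        rw [h, ← Finset.add_sum_erase _ _ (Finset.mem_univ i),
          ← Finset.add_sum_erase _ (fun k => (J k : ℕ)) (Finset.mem_univ i), Function.update_self,
          Finset.sum_congr rfl fun k hk => by
            rw [Function.update_of_ne (Finset.ne_of_mem_erase hk)]]
        ring
      omega
    · exact zero_mem _
  · split_ifs with h
    · subst h
      refine add_mem ?_ (intCast_mul_mem _ fun _ => ?_)
      · rw [← mul_one (b : MvPolynomial (Fin 2) ℤ)]
        refine intCast_mul_mem _ fun _ => ?_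
        rw [MvPolynomial.degreeOf_one]
        omega
      · have := degreeOf_X_mul_X_pow_le v 1
        rw [pow_one] at this
        omega
    · exact zero_mem _

end Degree

end Cogrowth

/-- Let `G₁,…,G_r` be finite groups with generating sets `S_i`
whose cogrowth series are `P_i/Q_i` with `P_i, Q_i ∈ ℤ[t]`, `P_i(0) = Q_i(0) = 1`,
and set `Δ_i = max(deg P_i + 1, deg Q_i)`.  Then the cogrowth series `F` of the
free product `G₁^{⋆m₁} ⋆ ⋯ ⋆ G_r^{⋆m_r}` with respect to the union `S` of the
copies of the `S_i` is algebraic, annihilated by a nonzero `Λ ∈ ℤ[t,z]` with both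
degrees at most `(∏ Δ_i)(1 + ∑ 1/Δ_i)`; in particular the bound is independent of
`m₁,…,m_r`. -/
theorem cogrowth_free_product_algebraic_bound {r : ℕ} (Gi : Fin r → Type)
    [∀ i, Group (Gi i)] [∀ i, Finite (Gi i)]
    (Si : ∀ i, Set (Gi i)) (hgen : ∀ i, Subgroup.closure (Si i) = ⊤)
    (P Q : Fin r → Polynomial ℤ)
    (hP0 : ∀ i, (P i).coeff 0 = 1) (hQ0 : ∀ i, (Q i).coeff 0 = 1)
    (hPQ : ∀ i, ((Q i : PowerSeries ℤ)) * cogrowthSeriesInt (Si i) = ((P i : PowerSeries ℤ)))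
    (Δ : Fin r → ℕ) (hΔ : ∀ i, Δ i = max ((P i).natDegree + 1) ((Q i).natDegree))
    (m : Fin r → ℕ) (hm : ∀ i, 0 < m i)
    (S : Set (Monoid.CoprodI (fun p : Σ i : Fin r, Fin (m i) => Gi p.1)))
    (hS : S = ⋃ p : Σ i : Fin r, Fin (m i),
      (Monoid.CoprodI.of (M := fun q : Σ i : Fin r, Fin (m i) => Gi q.1) (i := p)) '' (Si p.1))
    (F : PowerSeries ℚ) (hF : F = cogrowthSeries S) :
    ∃ Λ : MvPolynomial (Fin 2) ℤ, Λ ≠ 0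
      ∧ MvPolynomial.aeval ![PowerSeries.X, F] Λ = 0
      ∧ (MvPolynomial.degreeOf 0 Λ : ℚ)
          ≤ (∏ i, (Δ i : ℚ)) * (1 + ∑ i, (Δ i : ℚ)⁻¹)
      ∧ (MvPolynomial.degreeOf 1 Λ : ℚ)
          ≤ (∏ i, (Δ i : ℚ)) * (1 + ∑ i, (Δ i : ℚ)⁻¹) := by
  classical
  have := fun i => Fintype.ofFinite (Gi i)
  let T : ∀ i, Finset (Gi i) := fun i => (Si i).toFinset
  have hT : ∀ i, (T i : Set (Gi i)) = Si i := fun i => Set.coe_toFinset _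
  obtain ⟨c, hc⟩ := Cogrowth.exists_sum_unionOf (PowerSeries ℚ)
    (H := fun p : Σ i : Fin r, Fin (m i) => Gi p.1) fun p => T p.1
  have hST : S = (Cogrowth.unionOf (H := fun p : Σ i : Fin r, Fin (m i) => Gi p.1)
      fun p => T p.1 : Set _) := by
    rw [hS, Cogrowth.coe_unionOf]
    simp only [hT]
  obtain ⟨E, κ, D, hD, hE, hPE, hDκ⟩ :=
    Cogrowth.exists_excursions P Q hP0 hQ0 (fun i => (m i : ℚ)) (c : ℚ)
  have hγ := fun i => Cogrowth.exists_normalized_green (T i) (P i) (Q i) (hP0 i)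
    (by rw [hT]; exact hPQ i) (hE i) (hPE i)
  choose γ hγ1 hγ2 using hγ
  have hFD : F * D = 1 := by
    rw [hF, hST]
    refine Cogrowth.cogrowthSeries_unionOf_mul _ hc (fun p => γ p.1) (fun p => hγ1 p.1)
      (fun p => κ p.1) hD (fun p => hγ2 p.1) ?_
    rw [hDκ, Fintype.sum_sigma]
    simp
  have hd : ∀ i, 0 < Δ i := fun i => by
    rw [hΔ]
    omega
  refine ⟨Cogrowth.eliminant P Q Δ (fun i => m i) (1 - ∑ i, (m i : ℤ)) (-c),
    Cogrowth.eliminant_ne_zero _ _ _ _ _ _, ?_, ?_⟩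
  · refine Cogrowth.map_eliminant_eq_zero
      (MvPolynomial.aeval ![PowerSeries.X, F] : _ →ₐ[ℤ] PowerSeries ℚ).toRingHom
      P Q Δ hd _ _ _ (fun i => F * (D + PowerSeries.X * κ i)) (z := PowerSeries.X * F)
      (by simp) (fun i a => ?_) ?_
    · refine Cogrowth.pow_succ_eq_sum_companionEntry (u := PowerSeries.X * E i) ?_ ?_ (hQ0 i)
        (by rw [hΔ]; exact le_max_left _ _) (by rw [hΔ]; exact le_max_right _ _) a
      · linear_combination PowerSeries.X * F * hE i
      · rw [← hPE i]
        linear_combination Polynomial.aeval (PowerSeries.X * E i) (P i)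
            * (hFD - F * PowerSeries.X * κ i * hE i)
    · have hsum : ∑ i, (m i : PowerSeries ℚ) * (F * (D + PowerSeries.X * κ i)) =
          (∑ i, (m i : PowerSeries ℚ)) * (F * D)
            + F * (PowerSeries.X * ∑ i, (m i : PowerSeries ℚ) * κ i) := by
        simp only [Finset.mul_sum, Finset.sum_mul, ← Finset.sum_add_distrib]
        exact Finset.sum_congr rfl fun i _ => by ring
      simp only [map_natCast, map_intCast] at hDκ
      simp
      rw [hsum]
      linear_combination (-F) * hDκ + (1 - ∑ i, (m i : PowerSeries ℚ)) * hFD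
  · have hle : ∀ v, ((Cogrowth.eliminant P Q Δ (fun i => m i) (1 - ∑ i, (m i : ℤ))
        (-c)).degreeOf v : ℚ) ≤ (∏ i, (Δ i : ℚ)) * (1 + ∑ i, (Δ i : ℚ)⁻¹) := fun v => by
      have h1 : ((Cogrowth.eliminant P Q Δ (fun i => m i) (1 - ∑ i, (m i : ℤ))
          (-c)).degreeOf v : ℚ) ≤ ∏ i, (Δ i : ℚ) := by
        exact_mod_cast Cogrowth.degreeOf_eliminant_le v P Q Δ _ _ _
      refine h1.trans (le_mul_of_one_le_right (by positivity) ?_)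
      have : (0 : ℚ) ≤ ∑ i, (Δ i : ℚ)⁻¹ := by positivity
      linarith
    exact ⟨hle 0, hle 1⟩
end

section
/- Let H be a group with finite generating set T. Let G = ℤ ⋆ H with x the image of a generator of the infinite cyclic factor, and let S = {x, x^{−1}} ∪ T (T identified with its image under the canonical inclusion of H). Let G' = (ℤ/2ℤ) ⋆ (ℤ/2ℤ) ⋆ H with u and v the images of the generators of the two order-2 factors, and let S' = {u, v} ∪ T (T identified with its image in G'). Then CL(n;G,S) = CL(n;G',S') for every n ≥ 0; that is, G with generating set S and G' with generating set S' have the same cogrowth function. -/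
namespace TwistedWord

variable {ι K : Type*}

/-- The parity of the number of letters from the left summand. -/
def parity : List (Bool ⊕ ι) → Bool
  | [] => false
  | .inl _ :: l => !parity l
  | .inr _ :: l => parity l

/-- Flip each letter `.inl b` that has an odd number of letters `.inl _` to its right. -/
def twist : List (Bool ⊕ ι) → List (Bool ⊕ ι)
  | [] => []
  | .inl b :: l => .inl (xor b (parity l)) :: twist l
  | .inr t :: l => .inr t :: twist l

theorem parity_twist (l : List (Bool ⊕ ι)) : parity (twist l) = parity l := by
  induction l with
  | nil => rfl
  | cons a l ih => cases a <;> simp [twist, parity, ih]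

theorem twist_involutive : Function.Involutive (twist (ι := ι)) := by
  intro l
  induction l with
  | nil => rfl
  | cons a l ih => cases a <;> simp [twist, parity_twist, ih]

theorem length_twist (l : List (Bool ⊕ ι)) : (twist l).length = l.length := by
  induction l with
  | nil => rfl
  | cons a l ih => cases a <;> simp [twist, ih]

/-- If `G` acts on `K × Bool` so that each letter moves the first coordinate by the letter
twisted by the second one, then twisting preserves words representing the identity. -/
theorem prod_map_twist_eq_one {G : Type*} [Group G] [Group K]
    {e : Bool ⊕ ι → G} {e' : Bool ⊕ ι → K} (f : G →* Equiv.Perm (K × Bool))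
    (hinl : ∀ b k p, f (e (.inl b)) (k, p) = (e' (.inl (xor b p)) * k, !p))
    (hinr : ∀ t k p, f (e (.inr t)) (k, p) = (e' (.inr t) * k, p))
    {l : List (Bool ⊕ ι)} (hl : (l.map e).prod = 1) : ((twist l).map e').prod = 1 := by
  have key : ∀ l : List (Bool ⊕ ι),
      f (l.map e).prod (1, false) = (((twist l).map e').prod, parity l) := by
    intro l
    induction l with
    | nil => simp [twist, parity]
    | cons a l ih => cases a <;> simp [twist, parity, ih, hinl, hinr]
  have h := key l
  rw [hl, map_one] at h
  exact (congrArg Prod.fst h).symm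

/-- The permutation of `K × Bool` multiplying by `y p` in the fibre over `p` and then switching
fibres. -/
def switchPerm [Group K] (y : Bool → K) : Equiv.Perm (K × Bool) where
  toFun q := (y q.2 * q.1, !q.2)
  invFun q := ((y (!q.2))⁻¹ * q.1, !q.2)
  left_inv q := by simp
  right_inv q := by simp

/-- Left multiplication on the first coordinate of `K × Bool`, through a homomorphism. -/
def mulLeftFst {H : Type*} [Group H] [Group K] (j : H →* K) : H →* Equiv.Perm (K × Bool) where
  toFun h := (Equiv.mulLeft (j h)).prodCongr (Equiv.refl Bool)
  map_one' := by ext <;> simp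
  map_mul' a b := by ext <;> simp [mul_assoc]

/-- The homomorphism from `ℤ/2ℤ` determined by an element of square one. -/
def zmodTwoHom [Group K] (g : K) (hg : g * g = 1) : Multiplicative (ZMod 2) →* K :=
  AddMonoidHom.toMultiplicativeLeft
    (ZMod.lift 2 ⟨zmultiplesHom _ (Additive.ofMul g),
      (two_zsmul (Additive.ofMul g)).trans (congrArg Additive.ofMul hg)⟩)

theorem zmodTwoHom_ofAdd_one [Group K] (g : K) (hg : g * g = 1) :
    zmodTwoHom g hg (Multiplicative.ofAdd 1) = g := by
  have h := ZMod.lift_coe 2 (⟨zmultiplesHom _ (Additive.ofMul g),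
      (two_zsmul (Additive.ofMul g)).trans (congrArg Additive.ofMul hg)⟩ :
    {f : ℤ →+ Additive K // f (2 : ℕ) = 0}) 1
  rw [Int.cast_one] at h
  simp [zmodTwoHom, h]

theorem inv_map_zmodTwo_one [Group K] (f : Multiplicative (ZMod 2) →* K) :
    (f (Multiplicative.ofAdd 1))⁻¹ = f (Multiplicative.ofAdd 1) :=
  (map_inv f _).symm

theorem switchPerm_mul_self [Group K] (y : Bool → K) (hy : y true * y false = 1) :
    switchPerm y * switchPerm y = 1 := by
  have hy' : y false * y true = 1 := mul_eq_one_comm.mp hy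
  ext ⟨k, p⟩ <;> cases p <;> simp [switchPerm, ← mul_assoc, hy, hy']

end TwistedWord

theorem CL_eq_ncard {G α : Type*} [Group G] {S : Set G} {e : α → G} (he : Function.Injective e)
    (hS : Set.range e = S) (n : ℕ) :
    CL S n = {l : List α | l.length = n ∧ (l.map e).prod = 1}.ncard := by
  subst hS
  rw [← Set.ncard_image_of_injective _ (List.map_injective_iff.mpr he), CL]
  change Nat.card {w : Fin n → G | (∀ i, w i ∈ Set.range e) ∧ (List.ofFn w).prod = 1} = _
  rw [Nat.card_coe_set_eq, ← Set.ncard_image_of_injective _ List.ofFn_injective]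
  congr 1
  ext l
  constructor
  · rintro ⟨w, ⟨hw, hp⟩, rfl⟩
    choose a ha using hw
    obtain rfl : e ∘ a = w := funext ha
    exact ⟨List.ofFn a, ⟨by simp, by rwa [List.map_ofFn]⟩, by rw [List.map_ofFn]⟩
  · rintro ⟨l, ⟨rfl, hp⟩, rfl⟩
    have h : List.ofFn (fun i : Fin l.length => e (l.get i)) = l.map e := by
      rw [← Function.comp_def, ← List.map_ofFn, List.ofFn_get]
    exact ⟨fun i => e (l.get i), ⟨fun i => ⟨_, rfl⟩, by rwa [h]⟩, h⟩

open TwistedWord Monoid.Coprod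

/-- Let `H` be a group with finite generating set `T`.  Then
`ℤ ⋆ H` with generating set `{x, x⁻¹} ∪ T` and `(ℤ/2ℤ) ⋆ (ℤ/2ℤ) ⋆ H` with
generating set `{u, v} ∪ T` have the same cogrowth function. -/
theorem cogrowth_Z_star_eq_Z2_Z2_star {H : Type*} [Group H]
    (T : Set H) (hTfin : T.Finite) (hTgen : Subgroup.closure T = ⊤)
    (x : Monoid.Coprod (Multiplicative ℤ) H)
    (hx : x = Monoid.Coprod.inl (Multiplicative.ofAdd (1 : ℤ)))
    (u v : Monoid.Coprod (Multiplicative (ZMod 2)) (Monoid.Coprod (Multiplicative (ZMod 2)) H))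
    (hu : u = Monoid.Coprod.inl (Multiplicative.ofAdd (1 : ZMod 2)))
    (hv : v = Monoid.Coprod.inr (Monoid.Coprod.inl (Multiplicative.ofAdd (1 : ZMod 2)))) :
    ∀ n : ℕ,
      CL ({x, x⁻¹} ∪ (Monoid.Coprod.inr '' T)) n
        = CL ({u, v} ∪ ((fun h => Monoid.Coprod.inr (Monoid.Coprod.inr h)) '' T)) n := by
  intro n
  have hu' : u⁻¹ = u := by
    rw [hu]
    exact inv_map_zmodTwo_one
      (K := Monoid.Coprod (Multiplicative (ZMod 2)) (Monoid.Coprod (Multiplicative (ZMod 2)) H)) inl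
  have hv' : v⁻¹ = v := by
    rw [hv]
    exact inv_map_zmodTwo_one
      (K := Monoid.Coprod (Multiplicative (ZMod 2)) (Monoid.Coprod (Multiplicative (ZMod 2)) H))
      (inr.comp inl)
  let e : Bool ⊕ T → Monoid.Coprod (Multiplicative ℤ) H :=
    Sum.elim (fun b => cond b x⁻¹ x) (fun t => Monoid.Coprod.inr t.1)
  let e' : Bool ⊕ T →
      Monoid.Coprod (Multiplicative (ZMod 2)) (Monoid.Coprod (Multiplicative (ZMod 2)) H) :=
    Sum.elim (fun b => cond b v u) (fun t => Monoid.Coprod.inr (Monoid.Coprod.inr t.1))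
  have he : Function.Injective e := by
    have hfx : (fst x).toAdd = 1 := by simp [hx]
    have hfx' : (fst x⁻¹).toAdd = -1 := by simp [hx]
    refine Function.Injective.sumElim ?_ (fun s t h => Subtype.ext (inr_injective h)) ?_
    · have hne : x ≠ x⁻¹ := fun h => by
        rw [← h, hfx] at hfx'
        omega
      rintro (_ | _) (_ | _) h
      exacts [rfl, (hne h).elim, (hne h.symm).elim, rfl]
    · rintro (_ | _) t h
      · change x = _ at h
        simp [h] at hfx
      · change x⁻¹ = _ at h
        simp [h, -map_inv] at hfx'
  have he' : Function.Injective e' := by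
    have hfu : (fst u).toAdd = 1 := by simp [hu]
    have hfv : (fst v).toAdd = 0 := by simp [hv]
    have hfv' : (fst (snd v)).toAdd = 1 := by simp [hv]
    refine Function.Injective.sumElim ?_
      (fun s t h => Subtype.ext (inr_injective (inr_injective h))) ?_
    · have hne : u ≠ v := fun h => by
        rw [← h, hfu] at hfv
        exact one_ne_zero hfv
      rintro (_ | _) (_ | _) h
      exacts [rfl, (hne h).elim, (hne h.symm).elim, rfl]
    · rintro (_ | _) t h
      · change u = _ at h
        simp [h] at hfu
      · change v = _ at h
        simp [h] at hfv'
  have hS : Set.range e = {x, x⁻¹} ∪ Monoid.Coprod.inr '' T := by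
    ext g
    simp [e, eq_comm]
  have hS' : Set.range e' =
      {u, v} ∪ (fun h => Monoid.Coprod.inr (Monoid.Coprod.inr h)) '' T := by
    ext g
    simp [e', eq_comm]
  rw [CL_eq_ncard he hS, CL_eq_ncard he' hS', ← Set.ncard_image_of_injective _
    twist_involutive.injective]
  let f : Monoid.Coprod (Multiplicative ℤ) H →* Equiv.Perm (_ × Bool) :=
    lift (zpowersHom _ (switchPerm fun p => cond p v u)) (mulLeftFst (inr.comp inr))
  let f' : Monoid.Coprod (Multiplicative (ZMod 2)) (Monoid.Coprod (Multiplicative (ZMod 2)) H) →*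
      Equiv.Perm (_ × Bool) :=
    lift (zmodTwoHom (switchPerm fun p => cond p x⁻¹ x) (switchPerm_mul_self _ (by simp)))
      (lift (zmodTwoHom (switchPerm fun p => cond p x x⁻¹) (switchPerm_mul_self _ (by simp)))
        (mulLeftFst inr))
  have hfx : f x = switchPerm fun p => cond p v u := by simp [f, hx]
  have hfu : f' u = switchPerm fun p => cond p x⁻¹ x := by simp [f', hu, zmodTwoHom_ofAdd_one]
  have hfv : f' v = switchPerm fun p => cond p x x⁻¹ := by simp [f', hv, zmodTwoHom_ofAdd_one]
  have key {l} : (l.map e).prod = 1 → ((twist l).map e').prod = 1 := by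
    refine prod_map_twist_eq_one f ?_ ?_
    · rintro (_ | _) k (_ | _) <;>
        simp [e, e', hfx, switchPerm, Equiv.Perm.inv_def, hu', hv']
    · intro t k p
      simp [e, e', f, mulLeftFst]
  have key' {l} : (l.map e').prod = 1 → ((twist l).map e).prod = 1 := by
    refine prod_map_twist_eq_one 
      (G := Monoid.Coprod (Multiplicative (ZMod 2)) (Monoid.Coprod (Multiplicative (ZMod 2)) H)) f' ?_ ?_
    · rintro (_ | _) k (_ | _) <;> simp [e, e', hfu, hfv, switchPerm]
    · intro t k p
      simp [e, e', f', mulLeftFst]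
  congr 1
  ext l
  constructor
  · rintro ⟨l, ⟨hn, hl⟩, rfl⟩
    exact ⟨(length_twist l).trans hn, key hl⟩
  · rintro ⟨hn, hl⟩
    exact ⟨twist l, ⟨(length_twist l).trans hn, key' hl⟩, twist_involutive l⟩
end

section
/- Let d, m ≥ 2 be integers with (d, m) ≠ (2, 2), let β > 0 be a real number, and consider the polynomial P(z) = m^d·β^d·z^d − (z − 1)·(z + m − 1)^{d−1}. Then P has a repeated complex root, i.e. there exists z₀ ∈ ℂ with P(z₀) = 0 and P'(z₀) = 0, if and only if β = (d−1)^{(d−1)/d} / (d·(m−1)^{1/d}). -/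
/-- A common zero of `b z ^ (q + 2) - (z - 1) (z + k) ^ (q + 1)` and its derivative exists
exactly for one value of `b`. -/
theorem exists_double_zero_iff {K : Type*} [Field K] (q : ℕ) (b k : K) (hb : b ≠ 0) (hk : k ≠ 0)
    (hq : (q : K) + 2 ≠ 0) (hqk : ((q : K) + 1) * k - 1 ≠ 0) :
    (∃ z : K, b * z ^ (q + 2) - (z - 1) * (z + k) ^ (q + 1) = 0 ∧
      b * ((q + 2) * z ^ (q + 1)) -
        ((z + k) ^ (q + 1) + (z - 1) * ((q + 1) * (z + k) ^ q)) = 0) ↔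
      b * ((q + 2) ^ (q + 2) * k) = (k + 1) ^ (q + 2) * (q + 1) ^ (q + 1) := by
  have euler (z : K) : z * (b * ((q + 2) * z ^ (q + 1)) -
        ((z + k) ^ (q + 1) + (z - 1) * ((q + 1) * (z + k) ^ q))) -
      (q + 2) * (b * z ^ (q + 2) - (z - 1) * (z + k) ^ (q + 1)) =
      (z + k) ^ q * (z * ((q + 1) * k - 1) - (q + 2) * k) := by ring
  set z₀ : K := (q + 2) * k / ((q + 1) * k - 1) with hz₀
  have hz₀_ne : z₀ ≠ 0 := div_ne_zero (mul_ne_zero hq hk) hqk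
  have hsub : z₀ - 1 = (k + 1) / ((q + 1) * k - 1) := by
    rw [hz₀, div_sub_one hqk]; ring
  have hadd : z₀ + k = (q + 1) * k * (k + 1) / ((q + 1) * k - 1) := by
    rw [hz₀, div_add' _ _ _ hqk]; ring
  have hval : b * z₀ ^ (q + 2) - (z₀ - 1) * (z₀ + k) ^ (q + 1) =
      k ^ (q + 1) / ((q + 1) * k - 1) ^ (q + 2) *
        (b * ((q + 2) ^ (q + 2) * k) - (k + 1) ^ (q + 2) * (q + 1) ^ (q + 1)) := by
    rw [hsub, hadd, hz₀]
    simp only [div_pow, mul_pow]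
    field_simp
    ring
  have hfac : k ^ (q + 1) / ((q + 1) * k - 1) ^ (q + 2) ≠ 0 :=
    div_ne_zero (pow_ne_zero _ hk) (pow_ne_zero _ hqk)
  constructor
  · rintro ⟨z, h0, h1⟩
    have hz : z ≠ 0 := by
      rintro rfl
      simp [hk] at h0
    have hzk : z + k ≠ 0 := by
      intro h
      simp [h, hb, hz] at h0
    have hE := euler z
    rw [h0, h1, mul_zero, mul_zero, sub_zero, eq_comm, mul_eq_zero] at hE
    have hlin := hE.resolve_left (pow_ne_zero _ hzk)
    have hzz : z = z₀ := by
      rw [hz₀, eq_div_iff hqk]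
      exact sub_eq_zero.mp hlin
    rw [hzz, hval] at h0
    exact sub_eq_zero.mp ((mul_eq_zero.mp h0).resolve_left hfac)
  · intro h
    have h0 : b * z₀ ^ (q + 2) - (z₀ - 1) * (z₀ + k) ^ (q + 1) = 0 := by
      rw [hval, h, sub_self, mul_zero]
    refine ⟨z₀, h0, ?_⟩
    have hE := euler z₀
    have hlin : z₀ * ((q + 1) * k - 1) - (q + 2) * k = 0 := by
      rw [hz₀, div_mul_cancel₀ _ hqk, sub_self]
    rw [h0, hlin, mul_zero, mul_zero, sub_zero] at hE
    exact (mul_eq_zero.mp hE).resolve_left hz₀_ne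

/-- Taking the `d`-th power removes the fractional exponents. -/
theorem eq_rpow_div_rpow_iff (d : ℕ) (hd : d ≠ 0) (a k β : ℝ) (ha : 0 ≤ a) (hk : 0 < k)
    (hβ : 0 ≤ β) (n : ℕ) :
    β = a ^ ((n : ℝ) / d) / (d * k ^ ((1 : ℝ) / d)) ↔ β ^ d * (d ^ d * k) = a ^ n := by
  have hd' : (d : ℝ) ≠ 0 := Nat.cast_ne_zero.mpr hd
  have hpow : (a ^ ((n : ℝ) / d) / (d * k ^ ((1 : ℝ) / d))) ^ d = a ^ n / (d ^ d * k) := by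
    rw [div_pow, mul_pow, ← Real.rpow_mul_natCast ha, ← Real.rpow_mul_natCast hk.le,
      div_mul_cancel₀ _ hd', div_mul_cancel₀ _ hd', Real.rpow_natCast, Real.rpow_one]
  rw [← eq_div_iff (by positivity), ← hpow]
  exact (pow_left_inj₀ hβ (by positivity) hd).symm

/-- Let `d, m ≥ 2` with `(d,m) ≠ (2,2)` and `β > 0`.  The real
polynomial `P(z) = m^d β^d z^d − (z − 1)(z + m − 1)^{d−1}` has a repeated complex
root (i.e. a common complex root of `P` and `P'`) if and only if
`β = (d−1)^{(d−1)/d} / (d (m−1)^{1/d})`. -/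
theorem repeated_root_iff (d m : ℕ) (hd : 2 ≤ d) (hm : 2 ≤ m) (hdm : (d, m) ≠ (2, 2))
    (β : ℝ) (hβ : 0 < β)
    (P : Polynomial ℝ)
    (hP : P = Polynomial.C ((m : ℝ) ^ d * β ^ d) * Polynomial.X ^ d
      - (Polynomial.X - 1) * (Polynomial.X + Polynomial.C ((m : ℝ) - 1)) ^ (d - 1)) :
    (∃ z₀ : ℂ, Polynomial.aeval z₀ P = 0 ∧ Polynomial.aeval z₀ (Polynomial.derivative P) = 0)
      ↔ β = ((d : ℝ) - 1) ^ (((d : ℝ) - 1) / (d : ℝ))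
          / ((d : ℝ) * ((m : ℝ) - 1) ^ ((1 : ℝ) / (d : ℝ))) := by
  obtain ⟨q, rfl⟩ := Nat.exists_eq_add_of_le' hd
  have hm' : (2 : ℝ) ≤ m := by exact_mod_cast hm
  have hk : (0 : ℝ) < (m : ℝ) - 1 := by linarith
  have hqk : ((q : ℝ) + 1) * ((m : ℝ) - 1) - 1 ≠ 0 := by
    obtain ⟨p, rfl⟩ := Nat.exists_eq_add_of_le' hm
    have hpq : 0 < q + p := by
      by_contra h
      exact hdm (by ext <;> simp <;> omega)
    have hpq' : (0 : ℝ) < q + p := by exact_mod_cast hpq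
    have : (0 : ℝ) ≤ q * p := by positivity
    push_cast
    nlinarith
  have hβ_iff := eq_rpow_div_rpow_iff (q + 2) (by omega) ((q : ℝ) + 1) ((m : ℝ) - 1) β
    (by positivity) hk hβ.le (q + 1)
  have hexp : ((q + 2 : ℕ) : ℝ) - 1 = (q : ℝ) + 1 := by push_cast; ring
  rw [hexp]
  push_cast at hβ_iff ⊢
  rw [hβ_iff]
  have hcast := exists_double_zero_iff q (((m : ℝ) ^ (q + 2) * β ^ (q + 2) : ℝ) : ℂ)
    (((m : ℝ) - 1 : ℝ) : ℂ) (by exact_mod_cast (by positivity))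
    (by exact_mod_cast hk.ne')
    (by exact_mod_cast (by omega : q + 2 ≠ 0))
    (by exact_mod_cast hqk)
  have hreal : ((m : ℝ) ^ (q + 2) * β ^ (q + 2)) * (((q : ℝ) + 2) ^ (q + 2) * ((m : ℝ) - 1)) =
      ((m : ℝ) - 1 + 1) ^ (q + 2) * ((q : ℝ) + 1) ^ (q + 1) ↔
      β ^ (q + 2) * (((q : ℝ) + 2) ^ (q + 2) * ((m : ℝ) - 1)) = ((q : ℝ) + 1) ^ (q + 1) := by
    rw [sub_add_cancel, mul_assoc]
    exact mul_right_inj' (by positivity)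
  rw [← hreal]
  refine Iff.trans ?_ (hcast.trans (by norm_cast))
  have hq : q + 2 - 1 = q + 1 := rfl
  subst hP
  refine exists_congr fun z => ?_
  rw [hq]
  simp [Polynomial.derivative_pow, Polynomial.derivative_mul]
end

section
/- Let G₁, …, G_m be groups with generating sets S_i ⊆ G_i ∖ {1}, let G = G₁ ⋆ ⋯ ⋆ G_m be their free product, and let S = S₁ ∪ ⋯ ∪ S_m. Fix i ∈ {1,…,m}, an element g ∈ G_i with g ≠ 1, and a subset X ⊆ G_i with 1 ∉ X. Then the concatenation map (u, w) ↦ uw is a bijection from L_{1,X} × L_{g,X∪{1}} onto L_{g,X}. -/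
/-- `Lang S g X` is the set of words over the alphabet `S` whose product is `g`
and all of whose nonempty proper prefixes have product avoiding `X`. -/
def Lang {G : Type*} [Group G] (S : Set G) (g : G) (X : Set G) : Set (List G) :=
  {w | (∀ a ∈ w, a ∈ S) ∧ w.prod = g ∧ ∀ k, 1 ≤ k → k < w.length → (w.take k).prod ∉ X}

namespace Lang

variable {G : Type*} [Group G] {S X : Set G} {g : G} {u w u' w' : List G}

theorem append_mem (hX : (1 : G) ∉ X) (hu : u ∈ Lang S 1 X) (hw : w ∈ Lang S g (X ∪ {1})) :
    u ++ w ∈ Lang S g X := by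
  obtain ⟨huS, hu1, huX⟩ := hu
  obtain ⟨hwS, hwg, hwX⟩ := hw
  refine ⟨fun a ha ↦ (List.mem_append.1 ha).elim (huS a) (hwS a), by simp [hu1, hwg], ?_⟩
  intro k hk hkl
  rw [List.length_append] at hkl
  rw [List.take_append, List.prod_append]
  rcases lt_trichotomy k u.length with h | h | h
  · simpa [Nat.sub_eq_zero_of_le h.le] using huX k hk h
  · simpa [h, hu1] using hX
  · rw [List.take_of_length_le h.le, hu1, one_mul]
    exact fun hmem ↦ hwX (k - u.length) (by lia) (by lia) (Or.inl hmem)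

theorem length_le_of_append_eq (hg : g ≠ 1) (hu : u.prod = 1) (hu' : u'.prod = 1)
    (hw : w ∈ Lang S g (X ∪ {1})) (h : u ++ w = u' ++ w') : u'.length ≤ u.length := by
  by_contra! hlt
  obtain ⟨t, rfl⟩ : u <+: u' :=
    List.prefix_of_prefix_length_le ⟨w, h⟩ (List.prefix_append u' w') hlt.le
  obtain rfl : w = t ++ w' := by simpa using h
  obtain ⟨-, hwg, hwX⟩ := hw
  have ht : t.prod = 1 := by simpa [hu] using hu'
  have hw' : w' ≠ [] := by
    rintro rfl
    exact hg (by rw [← hwg, List.append_nil, ht])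
  have hpos := List.length_pos_iff.2 hw'
  rw [List.length_append] at hlt
  refine hwX t.length (by lia) (by rw [List.length_append]; lia) (Or.inr ?_)
  simpa using ht

theorem exists_append_eq (hw : w ∈ Lang S g X) :
    ∃ u ∈ Lang S 1 X, ∃ v ∈ Lang S g (X ∪ {1}), u ++ v = w := by
  classical
  obtain ⟨hwS, hwg, hwX⟩ := hw
  let P : ℕ → Prop := fun k ↦ (w.take k).prod = 1
  let k := Nat.findGreatest P w.length
  have hk : (w.take k).prod = 1 :=
    Nat.findGreatest_spec (P := P) (Nat.zero_le w.length) (by simp [P])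
  have hkl : k ≤ w.length := Nat.findGreatest_le _
  have hmax : ∀ j, k < j → j ≤ w.length → (w.take j).prod ≠ 1 :=
    fun j h₁ h₂ ↦ Nat.findGreatest_is_greatest h₁ h₂
  refine ⟨w.take k, ⟨fun a ha ↦ hwS a (List.mem_of_mem_take ha), hk, ?_⟩,
    w.drop k, ⟨fun a ha ↦ hwS a (List.mem_of_mem_drop ha), ?_, ?_⟩, List.take_append_drop k w⟩
  · intro j hj hjl
    rw [List.length_take] at hjl
    rw [List.take_take, min_eq_left (by lia)]
    exact hwX j hj (by lia)
  · rw [← hwg, ← List.prod_take_mul_prod_drop w k, hk, one_mul]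
  · intro j hj hjl
    rw [List.length_drop] at hjl
    have hprod : ((w.drop k).take j).prod = (w.take (k + j)).prod := by
      rw [List.take_add, List.prod_append, hk, one_mul]
    rw [hprod]
    rintro (h | h)
    · exact hwX (k + j) (by lia) (by lia) h
    · exact hmax (k + j) (by lia) (by lia) h

/-- Splitting a word at its last prefix with trivial product. -/
theorem bijOn_append (hg : g ≠ 1) (hX : (1 : G) ∉ X) :
    Set.BijOn (fun p : List G × List G ↦ p.1 ++ p.2)
      (Lang S 1 X ×ˢ Lang S g (X ∪ {1})) (Lang S g X) := by
  refine ⟨fun p hp ↦ append_mem hX hp.1 hp.2, ?_, ?_⟩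
  · rintro ⟨u, w⟩ ⟨hu, hw⟩ ⟨u', w'⟩ ⟨hu', hw'⟩ h
    have hlen : u.length = u'.length :=
      le_antisymm (length_le_of_append_eq hg hu'.2.1 hu.2.1 hw' h.symm)
        (length_le_of_append_eq hg hu.2.1 hu'.2.1 hw h)
    exact Prod.ext_iff.2 (List.append_inj h hlen)
  · intro w hw
    obtain ⟨u, hu, v, hv, rfl⟩ := exists_append_eq hw
    exact ⟨(u, v), ⟨hu, hv⟩, rfl⟩

end Lang

/-- In a free product `G = G₁ ⋆ ⋯ ⋆ G_m` with alphabet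
`S = S₁ ∪ ⋯ ∪ S_m`, for `g ∈ G_i ∖ {1}` and `X ⊆ G_i` with `1 ∉ X`, concatenation
is a bijection from `L_{1,X} × L_{g,X∪{1}}` onto `L_{g,X}`. -/
theorem lang_concat_bijOn {m : ℕ} (Gi : Fin m → Type*) [∀ i, Group (Gi i)]
    (Si : ∀ i, Set (Gi i)) (hS1 : ∀ i, (1 : Gi i) ∉ Si i)
    (hgen : ∀ i, Subgroup.closure (Si i) = ⊤)
    (S : Set (Monoid.CoprodI Gi))
    (hS : S = ⋃ j, Monoid.CoprodI.of '' Si j)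
    (i : Fin m) (g : Gi i) (hg : g ≠ 1) (X : Set (Gi i)) (hX : (1 : Gi i) ∉ X) :
    Set.BijOn (fun p : List (Monoid.CoprodI Gi) × List (Monoid.CoprodI Gi) => p.1 ++ p.2)
      ((Lang S 1 (Monoid.CoprodI.of '' X)) ×ˢ
        (Lang S (Monoid.CoprodI.of g) (Monoid.CoprodI.of '' X ∪ {1})))
      (Lang S (Monoid.CoprodI.of g) (Monoid.CoprodI.of '' X)) := by
  refine Lang.bijOn_append ?_ ?_
  · exact fun h ↦ hg (Monoid.CoprodI.of_injective i (by rw [h, map_one]))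
  · rintro ⟨x, hx, h⟩
    obtain rfl : x = 1 := Monoid.CoprodI.of_injective i (by rw [h, map_one])
    exact hX hx
end

section
/- Let G₁, …, G_m be groups with generating sets S_i ⊆ G_i ∖ {1}, let G = G₁ ⋆ ⋯ ⋆ G_m be their free product, and let S = S₁ ∪ ⋯ ∪ S_m. Fix i ∈ {1,…,m} and a subset X ⊆ G_i with 1 ∉ X. Then the concatenation map (u, w) ↦ uw is a bijection from L_{1,X} × (L_{1,X∪{1}} ∖ {ε}) onto L_{1,X} ∖ {ε}. -/
theorem mem_Lang_iff {G : Type*} [Group G] {S : Set G} {g : G} {X : Set G} {w : List G} :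
    w ∈ Lang S g X ↔ (∀ a ∈ w, a ∈ S) ∧ w.prod = g ∧
      ∀ a b, w = a ++ b → a ≠ [] → b ≠ [] → a.prod ∉ X := by
  refine and_congr_right fun _ => and_congr_right fun _ => ⟨?_, ?_⟩
  · rintro h a b rfl ha hb
    have := List.length_pos_iff.2 ha
    have := List.length_pos_iff.2 hb
    simpa using h a.length (by omega) (by simp; omega)
  · intro h k hk hkw
    refine h _ _ (List.take_append_drop k w).symm ?_ ?_
    · rw [← List.length_pos_iff, List.length_take]; omega
    · rw [← List.length_pos_iff, List.length_drop]; omega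

/-- A nonempty word with trivial product has a nonempty suffix with trivial product
none of whose nonempty proper prefixes has trivial product. -/
theorem exists_append_prod_eq_one {G : Type*} [Group G] (w : List G) (hw : w ≠ [])
    (hw1 : w.prod = 1) :
    ∃ u v, w = u ++ v ∧ u.prod = 1 ∧ v ≠ [] ∧ v.prod = 1 ∧
      ∀ a b, v = a ++ b → a ≠ [] → b ≠ [] → a.prod ≠ 1 := by
  by_cases h : ∀ a b, w = a ++ b → a ≠ [] → b ≠ [] → a.prod ≠ 1
  · exact ⟨[], w, rfl, rfl, hw, hw1, h⟩
  · push Not at h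
    obtain ⟨a, b, rfl, ha, hb, ha1⟩ := h
    have := List.length_pos_iff.2 ha
    obtain ⟨u, v, rfl, hu, hv⟩ :=
      exists_append_prod_eq_one b hb (by simpa [ha1] using hw1)
    exact ⟨a ++ u, v, by simp, by simp [ha1, hu], hv⟩
termination_by w.length
decreasing_by grind

theorem bijOn_append_Lang_one {G : Type*} [Group G] (S X : Set G) (hX : (1 : G) ∉ X) :
    Set.BijOn (fun p : List G × List G => p.1 ++ p.2)
      (Lang S 1 X ×ˢ (Lang S 1 (X ∪ {1}) \ {[]})) (Lang S 1 X \ {[]}) := by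
  refine ⟨?_, ?_, ?_⟩
  · rintro ⟨u, v⟩ ⟨hu, hv, hv0⟩
    obtain ⟨huS, hu1, hu⟩ := mem_Lang_iff.1 hu
    obtain ⟨hvS, hv1, hv⟩ := mem_Lang_iff.1 hv
    simp only [Set.mem_singleton_iff] at hv0
    refine ⟨mem_Lang_iff.2 ⟨?_, by simp [hu1, hv1], ?_⟩, by simp [hv0]⟩
    · intro a ha
      exact (List.mem_append.1 ha).elim (huS a) (hvS a)
    · intro a b hab ha hb
      rcases List.append_eq_append_iff.1 hab with ⟨c, rfl, hc⟩ | ⟨c, hc, rfl⟩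
      · rcases eq_or_ne c [] with rfl | hc0
        · simpa [hu1] using hX
        · simpa [hu1] using fun h => hv c b hc hc0 hb (Or.inl h)
      · rcases eq_or_ne c [] with rfl | hc0
        · rw [List.append_nil] at hc
          rwa [← hc, hu1]
        · exact hu a c hc ha hc0
  · rintro ⟨u, v⟩ ⟨hu, hv, hv0⟩ ⟨u', v'⟩ ⟨hu', hv', hv0'⟩ h
    have hu1 : u.prod = 1 := hu.2.1
    have hu1' : u'.prod = 1 := hu'.2.1
    have hv := (mem_Lang_iff.1 hv).2.2
    have hv' := (mem_Lang_iff.1 hv').2.2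
    rcases List.append_eq_append_iff.1 h with ⟨c, hc, hc'⟩ | ⟨c, hc, hc'⟩ <;>
      dsimp only at hc hc' <;> rcases eq_or_ne c [] with rfl | hc0
    · simp_all
    · refine absurd (Or.inr ?_) (hv c v' hc' hc0 hv0')
      simpa [hc, hu1] using hu1'
    · simp_all
    · refine absurd (Or.inr ?_) (hv' c v hc' hc0 hv0)
      simpa [hc, hu1'] using hu1
  · rintro w ⟨hw, hw0⟩
    obtain ⟨hwS, hw1, hw⟩ := mem_Lang_iff.1 hw
    obtain ⟨u, v, rfl, hu1, hv0, hv1, hv⟩ := exists_append_prod_eq_one w hw0 hw1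
    refine ⟨(u, v), ⟨mem_Lang_iff.2 ⟨?_, hu1, ?_⟩, mem_Lang_iff.2 ⟨?_, hv1, ?_⟩, hv0⟩, rfl⟩
    · exact fun a ha => hwS a (List.mem_append_left _ ha)
    · rintro a b rfl ha hb
      exact hw a (b ++ v) (by simp) ha (by simp [hb])
    · exact fun a ha => hwS a (List.mem_append_right _ ha)
    · rintro a b rfl ha hb (h | h)
      · exact hw (u ++ a) b (by simp) (by simp [ha]) hb (by simpa [hu1] using h)
      · exact hv a b rfl ha hb h

/-- In a free product `G = G₁ ⋆ ⋯ ⋆ G_m` with alphabet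
`S = S₁ ∪ ⋯ ∪ S_m`, for `X ⊆ G_i` with `1 ∉ X`, concatenation is a bijection
from `L_{1,X} × (L_{1,X∪{1}} ∖ {ε})` onto `L_{1,X} ∖ {ε}`. -/
theorem lang_concat_bijOn_one {m : ℕ} (Gi : Fin m → Type*) [∀ i, Group (Gi i)]
    (Si : ∀ i, Set (Gi i)) (hS1 : ∀ i, (1 : Gi i) ∉ Si i)
    (hgen : ∀ i, Subgroup.closure (Si i) = ⊤)
    (S : Set (Monoid.CoprodI Gi))
    (hS : S = ⋃ j, Monoid.CoprodI.of '' Si j)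
    (i : Fin m) (X : Set (Gi i)) (hX : (1 : Gi i) ∉ X) :
    Set.BijOn (fun p : List (Monoid.CoprodI Gi) × List (Monoid.CoprodI Gi) => p.1 ++ p.2)
      ((Lang S 1 (Monoid.CoprodI.of '' X)) ×ˢ
        ((Lang S 1 (Monoid.CoprodI.of '' X ∪ {1})) \ {[]}))
      ((Lang S 1 (Monoid.CoprodI.of '' X)) \ {[]}) := by
  refine bijOn_append_Lang_one S _ ?_
  rintro ⟨x, hx, hx1⟩
  rw [← map_one (Monoid.CoprodI.of (M := Gi) (i := i))] at hx1
  exact hX (Monoid.CoprodI.of_injective i hx1 ▸ hx)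
end

section
/- Let G₁, …, G_m be groups with generating sets S_i ⊆ G_i ∖ {1}, let G = G₁ ⋆ ⋯ ⋆ G_m be their free product, and let S = S₁ ∪ ⋯ ∪ S_m. Fix i ∈ {1,…,m}, an element g ∈ G_i with g ≠ 1, and a subset X ⊆ G_i with 1 ∈ X. Then L_{g,X} = E ∪ ⋃_{s ∈ S_i∖X} {s·w : w ∈ L_{s^{−1}g, s^{−1}X}}, where E = {the one-letter word g} if g ∈ S_i ∩ X and E = ∅ otherwise, and the sets appearing in this union (E and the sets {s·w : w ∈ L_{s^{−1}g, s^{−1}X}} for distinct s ∈ S_i∖X) are pairwise disjoint. In particular, every word in L_{g,X} of length at least 2 begins with a letter of S_i ∖ X. -/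
namespace Monoid.CoprodI

/-- Right multiplication by an element of a factor preserves the index of the first letter of a
reduced word, unless one of the two words involved is empty. -/
theorem Word.exists_prod_mul_of {ι : Type*} {M : ι → Type*} [∀ i, Monoid (M i)] {k : ι} (a : M k)
    (w : Word M) : ∃ w' : Word M, w'.prod = w.prod * of a ∧
      (w = Word.empty ∨ w' = Word.empty ∨ w'.fstIdx = w.fstIdx) := by
  classical
  induction w using Word.consRecOn with
  | empty => exact ⟨of a • Word.empty, by simp [Word.prod_smul], Or.inl rfl⟩
  | cons i m w hw hm ih =>
    have he : (Word.empty : Word M).fstIdx ≠ some i := by simp [Word.fstIdx, Word.empty]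
    obtain ⟨w', hprod, rfl | rfl | hidx⟩ := ih
    · by_cases hki : k = i
      · subst hki
        by_cases hma : m * a = 1
        · refine ⟨Word.empty, ?_, Or.inr (Or.inl rfl)⟩
          simp [Word.prod_cons, ← map_mul, hma]
        · refine ⟨Word.cons (m * a) Word.empty he hma, ?_, Or.inr (Or.inr ?_)⟩
          · simp [Word.prod_cons]
          · simp
      · by_cases ha : a = 1
        · exact ⟨Word.cons m Word.empty he hm, by simp [ha], Or.inr (Or.inr rfl)⟩
        · have hek : (Word.empty : Word M).fstIdx ≠ some k := by simp [Word.fstIdx, Word.empty]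
          refine ⟨Word.cons m (Word.cons a Word.empty hek ha) (by simpa using hki) hm, ?_,
            Or.inr (Or.inr ?_)⟩
          · simp [Word.prod_cons]
          · simp
    · refine ⟨Word.cons m Word.empty he hm, ?_, Or.inr (Or.inr ?_)⟩
      · rw [Word.prod_cons, Word.prod_cons, mul_assoc, ← hprod]
      · simp
    · refine ⟨Word.cons m w' (hidx ▸ hw) hm, ?_, Or.inr (Or.inr ?_)⟩
      · rw [Word.prod_cons, Word.prod_cons, mul_assoc, ← hprod]
      · simp

/-- A path in the free product that starts at a nonempty reduced word and never visits `1` does not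
change the index of the first letter. -/
theorem Word.exists_prod_mul_list_prod {ι : Type*} {M : ι → Type*} [∀ i, Monoid (M i)] {j : ι}
    (l : List (CoprodI M)) (hl : ∀ x ∈ l, ∃ k, ∃ a : M k, of a = x)
    (w : Word M) (hw : w.fstIdx = some j)
    (hne : ∀ n, 1 ≤ n → n ≤ l.length → w.prod * (l.take n).prod ≠ 1) :
    ∃ w' : Word M, w'.prod = w.prod * l.prod ∧ w'.fstIdx = some j := by
  induction l generalizing w with
  | nil => exact ⟨w, by simp, hw⟩
  | cons x l ih =>
    obtain ⟨k, a, rfl⟩ := hl x (by simp)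
    obtain ⟨w', hprod, rfl | rfl | hidx⟩ := Word.exists_prod_mul_of a w
    · simp [Word.fstIdx, Word.empty] at hw
    · exact absurd (by simpa using hprod.symm) (hne 1 le_rfl (by simp))
    · obtain ⟨v, hv, hvj⟩ := ih (fun y hy => hl y (by simp [hy])) w' (hidx.trans hw)
        (fun n _ hn' => by
          simpa [hprod, mul_assoc] using hne (n + 1) (by omega) (by simpa using hn'))
      exact ⟨v, by simp [hv, hprod, mul_assoc], hvj⟩

/-- A word in the letters of the factors whose first letter is a nontrivial element of the `j`-th
factor and which represents a nontrivial element of the `i`-th factor, `i ≠ j`, has a prefix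
that represents `1`. -/
theorem index_eq_of_take_prod_ne_one {ι : Type*} {M : ι → Type*} [∀ i, Monoid (M i)] {i j : ι}
    {g : M i} (hg : g ≠ 1) {s : M j} (hs : s ≠ 1) (l : List (CoprodI M))
    (hl : ∀ x ∈ l, ∃ k, ∃ a : M k, of a = x) (hprod : of s * l.prod = of g)
    (hne : ∀ n, 1 ≤ n → n < l.length → of s * (l.take n).prod ≠ 1) : j = i := by
  classical
  have hei : ∀ k, (Word.empty : Word M).fstIdx ≠ some k := by simp [Word.fstIdx, Word.empty]
  obtain ⟨w, hw, hwj⟩ := Word.exists_prod_mul_list_prod (j := j) l hl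
    (Word.cons s Word.empty (hei j) hs) (by simp) (fun n hn hn' => by
      rw [Word.prod_cons, Word.prod_empty, mul_one]
      rcases hn'.lt_or_eq with h | rfl
      · exact hne n hn h
      · rw [List.take_length, hprod]
        exact fun h => hg (of_injective i (h.trans (map_one of).symm)))
  have hwg : w = Word.cons g Word.empty (hei i) hg := by
    apply Word.equiv.symm.injective
    change w.prod = (Word.cons g Word.empty (hei i) hg).prod
    simp [hw, Word.prod_cons, hprod]
  simpa [hwg] using hwj.symm

end Monoid.CoprodI

/-- Removing a first letter that avoids `X` translates both the target and the forbidden set. -/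
theorem cons_mem_Lang_iff {G : Type*} [Group G] {S X : Set G} {g s : G} (hsX : s ∉ X)
    {w : List G} :
    s :: w ∈ Lang S g X ↔ s ∈ S ∧ w ∈ Lang S (s⁻¹ * g) ((fun a => s⁻¹ * a) '' X) := by
  have hmem : ∀ y, y ∈ (fun a => s⁻¹ * a) '' X ↔ s * y ∈ X := fun y => by
    constructor
    · rintro ⟨x, hx, rfl⟩
      simpa using hx
    · exact fun h => ⟨_, h, by simp⟩
  simp only [Lang, Set.mem_ofPred_eq, hmem, List.forall_mem_cons, List.prod_cons,
    List.length_cons, eq_inv_mul_iff_mul_eq]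
  constructor
  · rintro ⟨⟨hs, hw⟩, hp, hk⟩
    refine ⟨hs, hw, hp, fun k _ hk' => ?_⟩
    simpa using hk (k + 1) (by omega) (by omega)
  · rintro ⟨hs, hw, hp, hk⟩
    refine ⟨⟨hs, hw⟩, hp, fun k hk1 hk2 => ?_⟩
    obtain ⟨k, rfl⟩ := Nat.exists_eq_add_of_le' hk1
    rcases Nat.eq_zero_or_pos k with rfl | h
    · simpa using hsX
    · simpa using hk k h (by omega)

/-- In a free product `G = G₁ ⋆ ⋯ ⋆ G_m` with alphabet
`S = S₁ ∪ ⋯ ∪ S_m`, for `g ∈ G_i ∖ {1}` and `X ⊆ G_i` with `1 ∈ X`, we have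
`L_{g,X} = E ∪ ⋃_{s ∈ S_i∖X} s·L_{s⁻¹g, s⁻¹X}` where `E` is `{g}` (as a
one-letter word) if `g ∈ S_i ∩ X` and `∅` otherwise; the sets in this union are
pairwise disjoint, and every word in `L_{g,X}` of length at least `2` begins with
a letter of `S_i ∖ X`. -/
theorem lang_first_letter_decomposition {m : ℕ} (Gi : Fin m → Type*) [∀ i, Group (Gi i)]
    (Si : ∀ i, Set (Gi i)) (hS1 : ∀ i, (1 : Gi i) ∉ Si i)
    (hgen : ∀ i, Subgroup.closure (Si i) = ⊤)
    (S : Set (Monoid.CoprodI Gi))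
    (hS : S = ⋃ j, Monoid.CoprodI.of '' Si j)
    (i : Fin m) (g : Gi i) (hg : g ≠ 1) (X : Set (Gi i)) (hX : (1 : Gi i) ∈ X)
    (E : Set (List (Monoid.CoprodI Gi)))
    (hE : E = {l | g ∈ Si i ∩ X ∧ l = [Monoid.CoprodI.of g]})
    (prepLang : Gi i → Set (List (Monoid.CoprodI Gi)))
    (hprep : ∀ s : Gi i, prepLang s
      = (fun w => Monoid.CoprodI.of s :: w) ''
          Lang S (Monoid.CoprodI.of (s⁻¹ * g)) (Monoid.CoprodI.of '' ((fun a => s⁻¹ * a) '' X))) :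
    (Lang S (Monoid.CoprodI.of g) (Monoid.CoprodI.of '' X)
        = E ∪ ⋃ s ∈ Si i \ X, prepLang s)
      ∧ (∀ s ∈ Si i \ X, Disjoint E (prepLang s))
      ∧ (∀ s ∈ Si i \ X, ∀ t ∈ Si i \ X, s ≠ t → Disjoint (prepLang s) (prepLang t))
      ∧ (∀ w ∈ Lang S (Monoid.CoprodI.of g) (Monoid.CoprodI.of '' X),
          2 ≤ w.length → ∃ s ∈ Si i \ X, w.head? = some (Monoid.CoprodI.of s)) := by
  have hinj := Monoid.CoprodI.of_injective (M := Gi) i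
  have hmemX : ∀ a, Monoid.CoprodI.of a ∈ Monoid.CoprodI.of '' X ↔ a ∈ X :=
    fun a => hinj.mem_set_image
  have hprep_iff : ∀ s ∈ Si i \ X, ∀ w, w ∈ prepLang s ↔
      w ∈ Lang S (Monoid.CoprodI.of g) (Monoid.CoprodI.of '' X) ∧
        w.head? = some (Monoid.CoprodI.of s) := by
    rintro s ⟨hs, hsX⟩ w
    have hsS : Monoid.CoprodI.of s ∈ S := hS ▸ Set.mem_iUnion.2 ⟨i, s, hs, rfl⟩
    have himage : Monoid.CoprodI.of '' ((fun a => s⁻¹ * a) '' X)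
        = (fun a => (Monoid.CoprodI.of s)⁻¹ * a) '' (Monoid.CoprodI.of '' X) := by
      simp only [Set.image_image, map_mul, map_inv]
    rw [hprep, himage, map_mul, map_inv]
    constructor
    · rintro ⟨v, hv, rfl⟩
      exact ⟨(cons_mem_Lang_iff (by rwa [hmemX])).2 ⟨hsS, hv⟩, rfl⟩
    · rintro ⟨hw, hhead⟩
      obtain ⟨v, rfl⟩ := List.head?_eq_some_iff.1 hhead
      exact ⟨v, ((cons_mem_Lang_iff (by rwa [hmemX])).1 hw).2, rfl⟩
  have hhead : ∀ w ∈ Lang S (Monoid.CoprodI.of g) (Monoid.CoprodI.of '' X),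
      ∃ s ∈ Si i, w.head? = some (Monoid.CoprodI.of s) ∧
        (s ∈ X → w = [Monoid.CoprodI.of g]) := by
    rintro w ⟨hwS, hwg, hwX⟩
    obtain _ | ⟨x, l⟩ := w
    · exact absurd (hinj (by simpa using hwg.symm)) hg
    obtain ⟨j, s, hs, rfl⟩ : ∃ j, ∃ s ∈ Si j, Monoid.CoprodI.of s = x := by
      simpa [hS] using hwS x (by simp)
    obtain rfl : j = i := by
      refine Monoid.CoprodI.index_eq_of_take_prod_ne_one hg (fun h => hS1 j (h ▸ hs)) l
        (fun y hy => ?_) (by simpa using hwg) (fun n _ hn h1 => ?_)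
      · obtain ⟨k, a, -, ha⟩ : ∃ k, ∃ a ∈ Si k, Monoid.CoprodI.of a = y := by
          simpa [hS] using hwS y (by simp [hy])
        exact ⟨k, a, ha⟩
      · refine hwX (n + 1) (by omega) (by simpa using hn) ⟨1, hX, ?_⟩
        simpa using h1.symm
    refine ⟨s, hs, rfl, fun hsX => ?_⟩
    obtain _ | ⟨y, l⟩ := l
    · simpa using hwg
    · exact absurd ⟨s, hsX, by simp⟩ (hwX 1 le_rfl (by simp))
  refine ⟨?_, ?_, ?_, ?_⟩
  · ext w
    simp only [hE, Set.mem_union, Set.mem_iUnion, exists_prop]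
    constructor
    · intro hw
      obtain ⟨s, hs, hws, hsX⟩ := hhead w hw
      by_cases hX' : s ∈ X
      · obtain rfl := hsX hX'
        obtain rfl : g = s := hinj (by simpa using hws)
        exact Or.inl ⟨⟨hs, hX'⟩, rfl⟩
      · exact Or.inr ⟨s, ⟨hs, hX'⟩, (hprep_iff s ⟨hs, hX'⟩ w).2 ⟨hw, hws⟩⟩
    · rintro (⟨⟨hgS, -⟩, rfl⟩ | ⟨s, hs, hw⟩)
      · refine ⟨fun a ha => ?_, by simp, fun k hk hk' => ?_⟩
        · rw [List.mem_singleton.1 ha, hS]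
          exact Set.mem_iUnion.2 ⟨i, g, hgS, rfl⟩
        · rw [List.length_singleton] at hk'
          omega
      · exact ((hprep_iff s hs w).1 hw).1
  · intro s hs
    rw [Set.disjoint_left, hE]
    rintro w ⟨⟨-, hgX⟩, rfl⟩ hw
    obtain rfl : g = s := hinj (by simpa using ((hprep_iff s hs _).1 hw).2)
    exact hs.2 hgX
  · intro s hs t ht hst
    rw [Set.disjoint_left]
    intro w hws hwt
    exact hst (hinj (Option.some.inj
      (((hprep_iff s hs w).1 hws).2.symm.trans ((hprep_iff t ht w).1 hwt).2)))
  · intro w hw hlen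
    obtain ⟨s, hs, hws, hsX⟩ := hhead w hw
    refine ⟨s, ⟨hs, fun h => ?_⟩, hws⟩
    rw [hsX h, List.length_singleton] at hlen
    omega
end
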